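/- There exists a constant C > 0 depending only on n such that for all x₀ ∈ ℝⁿ, all r > 0, a > 0, T > 0, every u₀ ∈ C₀^∞(ℝⁿ;ℂ) and every ε ∈ (0,1): ∫_{ℝⁿ} |u₀(x)|² dx ≤ (1+T)^{2n+6} · exp( C^{1 + (|x₀|+r+1)/((aT) ∧ r)} ) · ( ε ( ∫_{ℝⁿ} e^{a|x|} |u₀(x)|² dx + ‖u₀‖²_{H^{n+3}(ℝⁿ;ℂ)} ) + ε · exp( exp( ε^{−2} ) ) · ∫_{B_r(x₀)} |u(x,T;u₀)|² dx ). -/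

import Mathlib

open MeasureTheory Filter Metric
open scoped Real RealInnerProductSpace ENNReal Topology

/-- The Fourier transform with the normalization
`f̂(ξ) = (2π)^{-n/2} ∫ f(x) e^{-i x·ξ} dx`. -/
noncomputable def fourierTransformPaper (n : ℕ) (f : EuclideanSpace ℝ (Fin n) → ℂ)
    (ξ : EuclideanSpace ℝ (Fin n)) : ℂ :=
  (((2 * Real.pi) ^ (-(n : ℝ) / 2) : ℝ) : ℂ) *
    ∫ x : EuclideanSpace ℝ (Fin n), Complex.exp (-Complex.I * (⟪x, ξ⟫ : ℝ)) * f x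

/-- The solution `u(·,t;f) = e^{itΔ} f` of the free Schrödinger equation with (nice) initial
datum `f`, obtained by Fourier inversion of `e^{-it|ξ|²} f̂(ξ)`. -/
noncomputable def schrodingerSol (n : ℕ) (f : EuclideanSpace ℝ (Fin n) → ℂ) (t : ℝ)
    (x : EuclideanSpace ℝ (Fin n)) : ℂ :=
  (((2 * Real.pi) ^ (-(n : ℝ) / 2) : ℝ) : ℂ) *
    ∫ ξ : EuclideanSpace ℝ (Fin n),
      Complex.exp (Complex.I * ((⟪x, ξ⟫ - t * ‖ξ‖ ^ 2 : ℝ) : ℂ)) * fourierTransformPaper n f ξ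

/-- `f ∈ C₀^∞(ℝⁿ; ℂ)`. -/
def IsTestFun (n : ℕ) (f : EuclideanSpace ℝ (Fin n) → ℂ) : Prop :=
  ContDiff ℝ (⊤ : ℕ∞) f ∧ HasCompactSupport f


lemma uc_cosh_one : (3 / 2 : ℝ) ≤ Real.cosh 1 ∧ Real.cosh 1 ≤ 2 := by
  have h1 := Real.exp_one_gt_d9
  have h2 := Real.exp_one_lt_d9
  have h3 : Real.exp (-1) * Real.exp 1 = 1 := by rw [← Real.exp_add]; simp
  have h4 : 0 < Real.exp (-1) := Real.exp_pos _
  rw [Real.cosh_eq]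
  constructor
  · nlinarith
  · nlinarith

lemma uc_sinh_two {s : ℝ} (h0 : 0 ≤ s) (h : s ≤ 2) : |Real.sinh s| ≤ 4 := by
  have h1 := Real.exp_one_lt_d9
  have h1' := Real.exp_one_gt_d9
  have h2 : Real.exp 2 = Real.exp 1 * Real.exp 1 := by rw [← Real.exp_add]; norm_num
  have h3 : Real.exp s ≤ Real.exp 2 := Real.exp_le_exp.2 h
  have h4 : 0 < Real.exp (-s) := Real.exp_pos _
  have h5 : 0 ≤ Real.sinh s := Real.sinh_nonneg_iff.2 h0
  rw [abs_of_nonneg h5, Real.sinh_eq]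
  nlinarith

lemma uc_cosh_im (z : ℂ) : (Complex.cosh z).im = Real.sinh z.re * Real.sin z.im := by
  conv_lhs => rw [← Complex.re_add_im z, Complex.cosh_add, Complex.cosh_mul_I, Complex.sinh_mul_I]
  simp [← Complex.ofReal_cosh, ← Complex.ofReal_sinh, ← Complex.ofReal_cos, ← Complex.ofReal_sin]

/-- One step of the propagation of smallness along a real line. -/
lemma uc_three_lines {g : ℂ → ℂ} (hg : Differentiable ℂ g) {δ m : ℝ} (hδ : 0 < δ)
    (hm0 : 0 ≤ m)
    (hB : ∀ z : ℂ, |z.im| ≤ 4 * δ → ‖g z‖ ≤ 1)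
    (hm : ∀ t : ℝ, |t| ≤ δ → ‖g t‖ ≤ m) :
    ‖g ((δ * Real.cosh 1 : ℝ) : ℂ)‖ ^ 2 ≤ m := by
  set h : ℂ → ℂ := fun z => g (δ * Complex.cosh z) with hh
  have hd : Differentiable ℂ h := hg.comp (by fun_prop)
  have hbd : ∀ z ∈ Complex.HadamardThreeLines.verticalClosedStrip 0 2, ‖h z‖ ≤ 1 := by
    intro z hz
    simp only [Complex.HadamardThreeLines.verticalClosedStrip, Set.mem_preimage, Set.mem_Icc] at hz
    apply hB
    rw [Complex.im_ofReal_mul, uc_cosh_im, abs_mul, abs_mul, abs_of_pos hδ]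
    have h1 := uc_sinh_two hz.1 hz.2
    have h2 := Real.abs_sin_le_one z.im
    have h3 : |Real.sinh z.re| * |Real.sin z.im| ≤ 4 * 1 := by gcongr
    nlinarith
  have key := Complex.HadamardThreeLines.norm_le_interp_of_mem_verticalClosedStrip' (f := h)
    (z := 1) (a := m) (b := 1) (l := 0) (u := 2) (by norm_num)
    (by simp [Complex.HadamardThreeLines.verticalClosedStrip]) hd.diffContOnCl
    ⟨1, by rintro _ ⟨z, hz, rfl⟩; exact hbd z hz⟩
    (by
      intro z hz
      simp only [Set.mem_preimage, Set.mem_singleton_iff] at hz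
      have hz' : z = z.im * Complex.I := by
        apply Complex.ext <;> simp [hz]
      have : h z = g ((δ * Real.cos z.im : ℝ) : ℂ) := by
        rw [hh]; simp only; congr 1
        conv_lhs => rw [hz', Complex.cosh_mul_I]
        push_cast; rfl
      rw [this]
      apply hm
      rw [abs_mul, abs_of_pos hδ]
      have := Real.abs_cos_le_one z.im
      nlinarith)
    (by
      intro z hz
      simp only [Set.mem_preimage, Set.mem_singleton_iff] at hz
      apply hbd
      simp [Complex.HadamardThreeLines.verticalClosedStrip, hz])
  have e1 : h 1 = g ((δ * Real.cosh 1 : ℝ) : ℂ) := by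
    rw [hh]; simp
  rw [e1] at key
  simp only [Complex.one_re, sub_zero, Real.one_rpow, mul_one] at key
  have : m ^ (1 - 1 / 2 : ℝ) = Real.sqrt m := by
    rw [Real.sqrt_eq_rpow]; norm_num
  rw [this] at key
  calc _ ≤ Real.sqrt m ^ 2 := by gcongr
    _ = m := Real.sq_sqrt hm0

/-- Chain of propagations of smallness. -/
lemma uc_chain {E : Type*} [NormedAddCommGroup E] [NormedSpace ℝ E] {G : E → ℂ} {δ m : ℝ}
    (hδ : 0 < δ) (hm0 : 0 ≤ m)
    (hG : ∀ c e : E, ‖e‖ = 1 → ∃ g : ℂ → ℂ, Differentiable ℂ g ∧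
      (∀ t : ℝ, g t = G (c + t • e)) ∧ ∀ z : ℂ, |z.im| ≤ 4 * δ → ‖g z‖ ≤ 1)
    (hG1 : ∀ x, ‖G x‖ ≤ 1)
    (x₀ : E) (hm : ∀ x ∈ closedBall x₀ (2 * δ), ‖G x‖ ≤ m) (k : ℕ) :
    ∀ x ∈ closedBall x₀ ((k / 2 + 2) * δ), ‖G x‖ ^ (2 ^ k) ≤ m := by
  induction k with
  | zero => simpa using hm
  | succ k ih =>
    intro x hx
    by_cases hxk : x ∈ closedBall x₀ ((k / 2 + 2) * δ)
    · refine le_trans ?_ (ih x hxk)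
      exact pow_le_pow_of_le_one (norm_nonneg _) (hG1 x) (Nat.pow_le_pow_right (by norm_num) (by omega))
    · obtain ⟨hc1, hc2⟩ := uc_cosh_one
      rw [mem_closedBall, dist_eq_norm] at hx hxk
      push Not at hxk
      set d := ‖x - x₀‖ with hd
      have hk0 : (0 : ℝ) ≤ k := by positivity
      have hdpos : 2 * δ < d := by nlinarith
      have hdpos' : 0 < d := by linarith
      set e : E := d⁻¹ • (x - x₀) with he
      have hen : ‖e‖ = 1 := by
        rw [he, norm_smul, norm_inv, Real.norm_of_nonneg hdpos'.le, ← hd]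
        field_simp
      have hxe : x = x₀ + d • e := by
        rw [he, smul_smul, mul_inv_cancel₀ hdpos'.ne']; simp
      set c : E := x₀ + (d - δ * Real.cosh 1) • e with hc
      obtain ⟨g, hg, hgt, hgB⟩ := hG c e hen
      set mk : ℝ := m ^ ((2 ^ k : ℕ) : ℝ)⁻¹ with hmk
      have hmk0 : 0 ≤ mk := by positivity
      have hmkp : mk ^ (2 ^ k) = m := Real.rpow_inv_natCast_pow hm0 (by positivity)
      have h1 := uc_three_lines hg hδ hmk0 hgB (by
        intro t ht
        rw [hgt]
        have hy : c + t • e ∈ closedBall x₀ ((k / 2 + 2) * δ) := by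
          rw [mem_closedBall, dist_eq_norm, hc]
          have : x₀ + (d - δ * Real.cosh 1) • e + t • e - x₀ = (d - δ * Real.cosh 1 + t) • e := by
            rw [add_smul]; abel
          rw [this, norm_smul, hen, mul_one, Real.norm_eq_abs]
          push_cast at hx
          rw [abs_le] at ht ⊢
          constructor
          · nlinarith
          · nlinarith
        have := ih _ hy
        rw [← hmkp] at this
        exact le_of_pow_le_pow_left₀ (by positivity) hmk0 this)
      have hcx : c + (δ * Real.cosh 1) • e = x := by
        rw [hxe, hc, add_assoc, ← add_smul]; simp
      rw [hgt, hcx] at h1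
      calc ‖G x‖ ^ 2 ^ (k + 1) = (‖G x‖ ^ 2) ^ (2 ^ k) := by rw [← pow_mul]; ring_nf
        _ ≤ mk ^ (2 ^ k) := by gcongr
        _ = m := hmkp

/-- From `L²` smallness on a ball to pointwise smallness. -/
lemma uc_start (n : ℕ) {G : EuclideanSpace ℝ (Fin n) → ℂ} {ρ r : ℝ} (hρ : 0 < ρ) (hr : ρ ≤ r)
    (hG1 : ∀ x, ‖G x‖ ≤ 1) (hL : ∀ x y, ‖G x - G y‖ ≤ 2 / ρ * ‖x - y‖)
    (x₀ x : EuclideanSpace ℝ (Fin n)) (hx : x ∈ closedBall x₀ (ρ / 2)) :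
    (volume.real (closedBall (0 : EuclideanSpace ℝ (Fin n)) 1)) * ‖G x‖ ^ (n + 2) ≤
      4 * (4 / ρ) ^ n * ∫ y in closedBall x₀ r, ‖G y‖ ^ 2 := by
  set p := ‖G x‖ with hp
  have hp0 : 0 ≤ p := norm_nonneg _
  have hp1 : p ≤ 1 := hG1 x
  set s := ρ * p / 4 with hs
  have hs0 : 0 ≤ s := by positivity
  have hsρ : s ≤ ρ / 4 := by rw [hs]; nlinarith
  have hcont : Continuous G := by
    have : LipschitzWith (Real.toNNReal (2 / ρ)) G := by
      apply LipschitzWith.of_dist_le_mul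
      intro a b
      rw [Real.coe_toNNReal _ (by positivity), dist_eq_norm, dist_eq_norm]
      exact hL a b
    exact this.continuous
  have hJnt : IntegrableOn (fun y => ‖G y‖ ^ 2) (closedBall x₀ r) :=
    ((by fun_prop : Continuous fun y => ‖G y‖ ^ 2).continuousOn).integrableOn_compact
      (isCompact_closedBall _ _)
  have hsub : closedBall x s ⊆ closedBall x₀ r := by
    apply closedBall_subset_closedBall'
    rw [mem_closedBall] at hx
    linarith
  have h1 : ∫ y in closedBall x s, ‖G y‖ ^ 2 ≤ ∫ y in closedBall x₀ r, ‖G y‖ ^ 2 :=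
    setIntegral_mono_set hJnt (Eventually.of_forall fun y => by positivity) hsub.eventuallyLE
  have h2 : ∫ y in closedBall x s, (p / 2) ^ 2 ≤ ∫ y in closedBall x s, ‖G y‖ ^ 2 := by
    apply setIntegral_mono_on
    · exact (continuousOn_const).integrableOn_compact (isCompact_closedBall _ _)
    · exact hJnt.mono_set hsub
    · exact measurableSet_closedBall
    · intro y hy
      have h3 := hL x y
      rw [mem_closedBall, dist_comm, dist_eq_norm] at hy
      have h4 : 2 / ρ * ‖x - y‖ ≤ p / 2 := by
        calc 2 / ρ * ‖x - y‖ ≤ 2 / ρ * s := by gcongr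
          _ = p / 2 := by rw [hs]; field_simp; ring
      have h5 : p ≤ ‖G y‖ + ‖G x - G y‖ := by
        rw [hp]; calc ‖G x‖ = ‖G y + (G x - G y)‖ := by congr 1; ring
          _ ≤ _ := norm_add_le _ _
      have : p / 2 ≤ ‖G y‖ := by linarith
      gcongr
  rw [setIntegral_const, smul_eq_mul] at h2
  have hvol : volume.real (closedBall x s) =
      s ^ n * volume.real (closedBall (0 : EuclideanSpace ℝ (Fin n)) 1) := by
    have := Measure.addHaar_real_closedBall' (volume : Measure (EuclideanSpace ℝ (Fin n))) x hs0
    simpa using this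
  rw [hvol] at h2
  have h6 := h2.trans h1
  calc _ = 4 * (4 / ρ) ^ n * (s ^ n * volume.real (closedBall (0 : EuclideanSpace ℝ (Fin n)) 1) * (p / 2) ^ 2) := by
        rw [hs, div_pow, div_pow, mul_pow]; field_simp; try ring
    _ ≤ _ := by gcongr

open scoped FourierTransform in
lemma uc_hat_eq (n : ℕ) (f : EuclideanSpace ℝ (Fin n) → ℂ) (ξ : EuclideanSpace ℝ (Fin n)) :
    fourierTransformPaper n f ξ =
      (((2 * Real.pi) ^ (-(n : ℝ) / 2) : ℝ) : ℂ) * 𝓕 f ((2 * π)⁻¹ • ξ) := by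
  rw [fourierTransformPaper, Real.fourier_eq']
  congr 2
  ext x
  rw [smul_eq_mul, inner_smul_right]
  congr 2
  have : (π : ℂ) ≠ 0 := by exact_mod_cast Real.pi_ne_zero
  push_cast
  field_simp

lemma uc_const (n : ℕ) : ((2 * Real.pi) ^ (-(n : ℝ) / 2) : ℝ) ^ 2 * (2 * π) ^ n = 1 := by
  have h : (0 : ℝ) < 2 * π := by positivity
  rw [← Real.rpow_natCast, ← Real.rpow_natCast, ← Real.rpow_mul h.le, ← Real.rpow_add h]
  have : -(n : ℝ) / 2 * (2 : ℕ) + n = 0 := by push_cast; ring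
  rw [this, Real.rpow_zero]

open scoped FourierTransform in
lemma uc_sol_eq (n : ℕ) (f : EuclideanSpace ℝ (Fin n) → ℂ) (T : ℝ)
    (x : EuclideanSpace ℝ (Fin n)) :
    schrodingerSol n f T x = ∫ η, Complex.exp (2 * π * Complex.I * ⟪x, η⟫ -
      4 * π ^ 2 * T * Complex.I * ‖η‖ ^ 2) * 𝓕 f η := by
  have hpi : (π : ℂ) ≠ 0 := by exact_mod_cast Real.pi_ne_zero
  have h2 : (0 : ℝ) < 2 * π := by positivity
  rw [schrodingerSol]
  set κ : ℝ := (2 * Real.pi) ^ (-(n : ℝ) / 2) with hκ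
  set Φ : EuclideanSpace ℝ (Fin n) → ℂ := fun η => Complex.exp (2 * π * Complex.I * ⟪x, η⟫ -
      4 * π ^ 2 * T * Complex.I * ‖η‖ ^ 2) * 𝓕 f η with hΦ
  have e1 : ∀ ξ : EuclideanSpace ℝ (Fin n),
      Complex.exp (Complex.I * ((⟪x, ξ⟫ - T * ‖ξ‖ ^ 2 : ℝ) : ℂ)) * fourierTransformPaper n f ξ
      = κ * Φ ((2 * π)⁻¹ • ξ) := by
    intro ξ
    rw [uc_hat_eq, hΦ]
    simp only
    rw [inner_smul_right, norm_smul, Real.norm_of_nonneg (by positivity)]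
    rw [← mul_assoc, mul_comm _ (κ : ℂ), mul_assoc]
    congr 3
    push_cast
    field_simp
    ring
  simp_rw [e1]
  rw [integral_const_mul, Measure.integral_comp_inv_smul_of_nonneg _ _ h2.le, ← mul_assoc]
  rw [finrank_euclideanSpace_fin, Complex.real_smul, ← mul_assoc]
  have := uc_const n
  rw [← hκ] at this
  have h3 : (κ : ℂ) * κ * (((2 * π) ^ n : ℝ) : ℂ) = 1 := by
    rw [← Complex.ofReal_mul, ← Complex.ofReal_mul, ← sq, this]; simp
  rw [h3, one_mul]

/-- The chirped initial datum. -/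
noncomputable def ucChirp (n : ℕ) (f : EuclideanSpace ℝ (Fin n) → ℂ) (T : ℝ)
    (y : EuclideanSpace ℝ (Fin n)) : ℂ :=
  Complex.exp (Complex.I * ((‖y‖ ^ 2 / (4 * T) : ℝ) : ℂ)) * f y

open scoped FourierTransform in
lemma uc_gauss (n : ℕ) {f : EuclideanSpace ℝ (Fin n) → ℂ} (hf : Integrable f) {b : ℂ}
    (hb : 0 < b.re) (x : EuclideanSpace ℝ (Fin n)) :
    ∫ η, Complex.exp (-b * ‖η‖ ^ 2 + 2 * π * Complex.I * ⟪x, η⟫) * 𝓕 f η =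
    (π / b) ^ (n / 2 : ℂ) * ∫ y, Complex.exp (-π ^ 2 * ‖x - y‖ ^ 2 / b) * f y := by
  have hg : Integrable (fun η : EuclideanSpace ℝ (Fin n) =>
      Complex.exp (-b * ‖η‖ ^ 2 + 2 * π * Complex.I * ⟪x, η⟫)) := by
    simpa using GaussianFourier.integrable_cexp_neg_mul_sq_norm_add hb (2 * π * Complex.I) x
  have := VectorFourier.integral_bilin_fourierIntegral_eq_flip (ContinuousLinearMap.mul ℂ ℂ)
    (L := innerₗ (EuclideanSpace ℝ (Fin n))) Real.continuous_fourierChar continuous_inner hg hf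
      (μ := volume) (ν := volume)
  have h2 : ∫ η, 𝓕 (fun η : EuclideanSpace ℝ (Fin n) =>
      Complex.exp (-b * ‖η‖ ^ 2 + 2 * π * Complex.I * ⟪x, η⟫)) η * f η =
      ∫ η, Complex.exp (-b * ‖η‖ ^ 2 + 2 * π * Complex.I * ⟪x, η⟫) * 𝓕 f η := by
    simpa using! this
  rw [← h2, ← integral_const_mul]
  congr 1
  ext y
  rw [fourier_gaussian_innerProductSpace' hb, finrank_euclideanSpace_fin, mul_assoc]

open scoped FourierTransform in
lemma uc_fresnel (n : ℕ) {f : EuclideanSpace ℝ (Fin n) → ℂ} (hf : Integrable f)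
    (hf' : Integrable (𝓕 f)) {T : ℝ} (hT : 0 < T) (x : EuclideanSpace ℝ (Fin n)) :
    schrodingerSol n f T x = (π / (4 * π ^ 2 * T * Complex.I)) ^ (n / 2 : ℂ) *
      ∫ y, Complex.exp (-π ^ 2 * ‖x - y‖ ^ 2 / (4 * π ^ 2 * T * Complex.I)) * f y := by
  have hpi : (π : ℂ) ≠ 0 := by exact_mod_cast Real.pi_ne_zero
  have hTc : (T : ℂ) ≠ 0 := by exact_mod_cast hT.ne'
  set b₀ : ℂ := 4 * π ^ 2 * T * Complex.I with hb₀
  have hb₀0 : b₀ ≠ 0 := by rw [hb₀]; simp [hpi, hTc]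
  set b : ℝ → ℂ := fun δ => δ + b₀ with hb
  have hbre : ∀ δ : ℝ, (b δ).re = δ := by
    intro δ
    have : b δ = (δ : ℂ) + ((4 * π ^ 2 * T : ℝ) : ℂ) * Complex.I := by
      rw [hb, hb₀]; push_cast; ring
    rw [this, Complex.add_re, Complex.re_ofReal_mul]; simp
  have hbt : Tendsto b (𝓝[>] 0) (𝓝 b₀) := by
    have : Continuous b := by rw [hb]; fun_prop
    have h := (this.tendsto 0).mono_left (nhdsWithin_le_nhds (s := Set.Ioi 0))
    simpa [hb] using h
  have hpos : ∀ᶠ δ : ℝ in 𝓝[>] 0, 0 < δ := eventually_mem_nhdsWithin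
  have hL : Tendsto (fun δ : ℝ => ∫ η, Complex.exp (-(b δ) * ‖η‖ ^ 2 +
      2 * π * Complex.I * ⟪x, η⟫) * 𝓕 f η) (𝓝[>] 0) (𝓝 (schrodingerSol n f T x)) := by
    rw [uc_sol_eq]
    apply tendsto_integral_filter_of_dominated_convergence (fun η => ‖𝓕 f η‖)
    · filter_upwards with δ
      exact (Continuous.aestronglyMeasurable (by fun_prop)).mul hf'.1
    · filter_upwards [hpos] with δ hδ
      filter_upwards with η
      rw [norm_mul, Complex.norm_exp]
      have : (-(b δ) * ‖η‖ ^ 2 + 2 * π * Complex.I * ⟪x, η⟫).re = - δ * ‖η‖ ^ 2 := by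
        have : (-(b δ) * ‖η‖ ^ 2 + 2 * π * Complex.I * ⟪x, η⟫) =
          (-(b δ) * ((‖η‖ ^ 2 : ℝ) : ℂ) + ((2 * π * ⟪x, η⟫ : ℝ) : ℂ) * Complex.I) := by
          push_cast; ring
        rw [this, Complex.add_re, Complex.re_mul_ofReal]
        simp [hbre]
      rw [this]
      have : Real.exp (-δ * ‖η‖ ^ 2) ≤ 1 := by
        rw [Real.exp_le_one_iff]; nlinarith [sq_nonneg ‖η‖]
      nlinarith [norm_nonneg (𝓕 f η)]
    · exact hf'.norm
    · filter_upwards with η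
      apply Tendsto.mul_const
      have hc : Continuous fun c : ℂ => Complex.exp (-c * ‖η‖ ^ 2 + 2 * π * Complex.I * ⟪x, η⟫) := by
        fun_prop
      have := (hc.tendsto b₀).comp hbt
      convert! this using 2
      rw [hb₀]; congr 1; ring
  have hR : Tendsto (fun δ : ℝ => (π / b δ) ^ (n / 2 : ℂ) *
      ∫ y, Complex.exp (-π ^ 2 * ‖x - y‖ ^ 2 / b δ) * f y) (𝓝[>] 0)
      (𝓝 ((π / b₀) ^ (n / 2 : ℂ) * ∫ y, Complex.exp (-π ^ 2 * ‖x - y‖ ^ 2 / b₀) * f y)) := by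
    apply Tendsto.mul
    · have h1 : Tendsto (fun δ => (π : ℂ) / b δ) (𝓝[>] 0) (𝓝 (π / b₀)) :=
        tendsto_const_nhds.div hbt hb₀0
      apply h1.cpow tendsto_const_nhds
      right
      have : (π : ℂ) / b₀ = ((-(1 / (4 * π * T)) : ℝ) : ℂ) * Complex.I := by
        rw [hb₀]; push_cast; field_simp; simp
      rw [this]
      simp [Real.pi_ne_zero, hT.ne']
    · apply tendsto_integral_filter_of_dominated_convergence (fun η => ‖f η‖)
      · filter_upwards with δ
        exact (Continuous.aestronglyMeasurable (by fun_prop)).mul hf.1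
      · filter_upwards [hpos] with δ hδ
        filter_upwards with y
        rw [norm_mul, Complex.norm_exp]
        have : (-π ^ 2 * ‖x - y‖ ^ 2 / b δ : ℂ).re ≤ 0 := by
          have : (-π ^ 2 * ‖x - y‖ ^ 2 / b δ : ℂ) = ((-(π ^ 2 * ‖x - y‖ ^ 2) : ℝ) : ℂ) * (b δ)⁻¹ := by
            push_cast; ring
          rw [this, Complex.re_ofReal_mul, Complex.inv_re, hbre]
          have h1 : 0 ≤ δ / Complex.normSq (b δ) := by
            have := Complex.normSq_nonneg (b δ); positivity
          have h2 : 0 ≤ π ^ 2 * ‖x - y‖ ^ 2 := by positivity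
          nlinarith
        have : Real.exp (-π ^ 2 * ‖x - y‖ ^ 2 / b δ : ℂ).re ≤ 1 := by
          rwa [Real.exp_le_one_iff]
        nlinarith [norm_nonneg (f y)]
      · exact hf.norm
      · filter_upwards with y
        apply Tendsto.mul_const
        exact (Complex.continuous_exp.tendsto _).comp (tendsto_const_nhds.div hbt hb₀0)
  refine tendsto_nhds_unique (hL.congr' ?_) hR
  filter_upwards [hpos] with δ hδ
  exact uc_gauss n hf (by rw [hbre]; exact hδ) x

open scoped FourierTransform in
/-- Modulus of the solution in terms of the Fourier transform of the chirped datum. -/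
lemma uc_norm_sol (n : ℕ) {f : EuclideanSpace ℝ (Fin n) → ℂ} (hf : Integrable f)
    (hf' : Integrable (𝓕 f)) {T : ℝ} (hT : 0 < T) (x : EuclideanSpace ℝ (Fin n)) :
    ‖schrodingerSol n f T x‖ = (4 * π * T) ^ (-(n : ℝ) / 2) *
      ‖𝓕 (ucChirp n f T) ((4 * π * T)⁻¹ • x)‖ := by
  have hpi : (π : ℂ) ≠ 0 := by exact_mod_cast Real.pi_ne_zero
  have hTc : (T : ℂ) ≠ 0 := by exact_mod_cast hT.ne'
  rw [uc_fresnel n hf hf' hT, norm_mul]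
  congr 1
  · have h0 : (π : ℂ) / (4 * π ^ 2 * T * Complex.I) ≠ 0 := by simp [hpi, hTc]
    have h1 : (n / 2 : ℂ) = ((n / 2 : ℝ) : ℂ) := by push_cast; rfl
    rw [h1, Complex.norm_cpow_real]
    have h2 : ‖(π : ℂ) / (4 * π ^ 2 * T * Complex.I)‖ = (4 * π * T)⁻¹ := by
      rw [norm_div, norm_mul, norm_mul, norm_mul, norm_pow]
      simp only [Complex.norm_real, Complex.norm_I, Real.norm_of_nonneg Real.pi_pos.le,
        Real.norm_of_nonneg hT.le]
      norm_num
      field_simp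
    rw [h2, Real.inv_rpow (by positivity), ← Real.rpow_neg (by positivity)]
    congr 1; ring
  · rw [Real.fourier_eq']
    have h1 : ∀ y : EuclideanSpace ℝ (Fin n),
        Complex.exp (-π ^ 2 * ‖x - y‖ ^ 2 / (4 * π ^ 2 * T * Complex.I)) * f y =
        Complex.exp (((‖x‖ ^ 2 / (4 * T) : ℝ) : ℂ) * Complex.I) *
          (Complex.exp (↑(-2 * π * ⟪y, (4 * π * T)⁻¹ • x⟫) * Complex.I) • ucChirp n f T y) := by
      intro y
      have h2 : ((‖x - y‖ : ℂ)) ^ 2 = ((‖x‖ ^ 2 - 2 * ⟪y, x⟫ + ‖y‖ ^ 2 : ℝ) : ℂ) := by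
        rw [← Complex.ofReal_pow, norm_sub_sq_real, real_inner_comm]
      rw [ucChirp, smul_eq_mul, ← mul_assoc, ← mul_assoc, ← Complex.exp_add, ← Complex.exp_add, h2,
        inner_smul_right]
      congr 2
      have hI : Complex.I ≠ 0 := Complex.I_ne_zero
      have hI2 : Complex.I ^ 2 = -1 := Complex.I_sq
      push_cast
      field_simp
      rw [hI2]
      ring
    simp_rw [h1]
    rw [integral_const_mul, norm_mul, Complex.norm_exp_ofReal_mul_I, one_mul]

section UCPlancherel
open scoped FourierTransform LineDeriv SchwartzMap

lemma uc_inner_single {n : ℕ} (w : EuclideanSpace ℝ (Fin n)) (j : Fin n) :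
    (⟪w, EuclideanSpace.single j (1 : ℝ)⟫ : ℝ) = w j := by
  rw [EuclideanSpace.inner_single_right]; simp

lemma uc_schwartz_int (n : ℕ) (f : 𝓢(EuclideanSpace ℝ (Fin n), ℂ)) (k : ℕ) :
    Integrable (fun w => (1 + ‖w‖ ^ 2) ^ k * ‖f w‖ ^ 2) := by
  obtain ⟨C, hC⟩ : ∃ C, ∀ x, ‖f x‖ ≤ C := by
    obtain ⟨C, _, hC⟩ := f.decay 0 0
    exact ⟨C, by simpa using hC⟩
  have hi : Integrable (fun w => (2 ^ k * C) * (‖f w‖ + ‖w‖ ^ (2 * k) * ‖f w‖)) := by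
    apply Integrable.const_mul
    have h0 := f.integrable_pow_mul volume 0
    simp only [pow_zero, one_mul] at h0
    exact h0.add (f.integrable_pow_mul volume (2 * k))
  refine hi.mono' ?_ ?_
  · have := f.continuous
    exact Continuous.aestronglyMeasurable (by fun_prop)
  · filter_upwards with w
    rw [Real.norm_of_nonneg (by positivity)]
    have h1 : (1 + ‖w‖ ^ 2) ^ k ≤ 2 ^ k * (1 + ‖w‖ ^ (2 * k)) := by
      rcases le_total (‖w‖ ^ 2) 1 with h | h
      · calc (1 + ‖w‖ ^ 2) ^ k ≤ 2 ^ k := by gcongr; linarith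
          _ ≤ _ := by
            have : 0 ≤ ‖w‖ ^ (2 * k) := by positivity
            nlinarith [pow_pos (two_pos : (0 : ℝ) < 2) k]
      · calc (1 + ‖w‖ ^ 2) ^ k ≤ (2 * ‖w‖ ^ 2) ^ k := by gcongr; linarith
          _ = 2 ^ k * ‖w‖ ^ (2 * k) := by rw [mul_pow, ← pow_mul]
          _ ≤ _ := by nlinarith [pow_pos (two_pos : (0 : ℝ) < 2) k]
    have h2 : ‖f w‖ ^ 2 ≤ C * ‖f w‖ := by nlinarith [hC w, norm_nonneg (f w)]
    calc (1 + ‖w‖ ^ 2) ^ k * ‖f w‖ ^ 2 ≤ (2 ^ k * (1 + ‖w‖ ^ (2 * k))) * (C * ‖f w‖) := by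
          gcongr
      _ = _ := by ring

lemma uc_schwartz_int0 (n : ℕ) (f : 𝓢(EuclideanSpace ℝ (Fin n), ℂ)) :
    Integrable (fun w => ‖f w‖ ^ 2) := by
  simpa using uc_schwartz_int n f 0

lemma uc_schwartz_int2 (n : ℕ) (f : 𝓢(EuclideanSpace ℝ (Fin n), ℂ)) :
    Integrable (fun w => ‖w‖ ^ 2 * ‖f w‖ ^ 2) := by
  have h := (uc_schwartz_int n f 1).sub (uc_schwartz_int n f 0)
  refine h.congr (Eventually.of_forall fun w => ?_)
  simp
  ring

lemma uc_grad (n : ℕ) (f : 𝓢(EuclideanSpace ℝ (Fin n), ℂ)) :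
    ∫ w, (2 * π) ^ 2 * (‖w‖ ^ 2 * ‖𝓕 (f : EuclideanSpace ℝ (Fin n) → ℂ) w‖ ^ 2) =
      ∑ j, ∫ y, ‖fderiv ℝ f y (EuclideanSpace.single j 1)‖ ^ 2 := by
  have h1 : ∀ j : Fin n, ∫ y, ‖fderiv ℝ f y (EuclideanSpace.single j 1)‖ ^ 2 =
      ∫ w, (2 * π) ^ 2 * ((w j) ^ 2 * ‖𝓕 f w‖ ^ 2) := by
    intro j
    have := SchwartzMap.integral_norm_sq_fourier (∂_{EuclideanSpace.single j (1 : ℝ)} f)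
    rw [SchwartzMap.fourier_lineDerivOp_eq] at this
    simp only [SchwartzMap.lineDerivOp_apply_eq_fderiv] at this
    rw [← this]
    congr 1
    ext w
    have ht : (inner ℝ · (EuclideanSpace.single j (1 : ℝ)) :
      EuclideanSpace ℝ (Fin n) → ℝ).HasTemperateGrowth := by fun_prop
    rw [smul_apply, SchwartzMap.smulLeftCLM_apply_apply ht]
    rw [norm_smul, norm_smul]
    rw [uc_inner_single]
    simp [mul_pow]
  simp_rw [h1]
  rw [← integral_finsetSum]
  · congr 1
    ext w
    rw [← Finset.mul_sum, ← Finset.sum_mul, EuclideanSpace.norm_sq_eq]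
    simp [SchwartzMap.fourier_coe]
  · intro j _
    apply Integrable.const_mul
    refine (uc_schwartz_int2 n (𝓕 f)).mono' ?_ ?_
    · have := (𝓕 f).continuous
      exact Continuous.aestronglyMeasurable (by fun_prop)
    · filter_upwards with w
      rw [Real.norm_of_nonneg (by positivity)]
      apply mul_le_mul_of_nonneg_right _ (by positivity)
      rw [EuclideanSpace.norm_sq_eq]
      have := Finset.single_le_sum (f := fun i => ‖w i‖ ^ 2) (fun i _ => by positivity)
        (Finset.mem_univ j)
      simpa using this

/-- The Schwartz function attached to a test function. -/
noncomputable def ucSch {n : ℕ} {f : EuclideanSpace ℝ (Fin n) → ℂ} (h : IsTestFun n f) :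
    𝓢(EuclideanSpace ℝ (Fin n), ℂ) := h.2.toSchwartzMap h.1

lemma ucSch_coe {n : ℕ} {f : EuclideanSpace ℝ (Fin n) → ℂ} (h : IsTestFun n f) :
    (ucSch h : EuclideanSpace ℝ (Fin n) → ℂ) = f := rfl

lemma uc_chirp_test {n : ℕ} {f : EuclideanSpace ℝ (Fin n) → ℂ} (h : IsTestFun n f) (T : ℝ) :
    IsTestFun n (ucChirp n f T) := by
  constructor
  · unfold ucChirp
    apply ContDiff.mul _ h.1
    apply ContDiff.cexp
    apply contDiff_const.mul
    apply Complex.ofRealCLM.contDiff.comp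
    exact (contDiff_norm_sq ℝ).div_const _
  · exact h.2.mul_left

lemma uc_integrable_hat {n : ℕ} {f : EuclideanSpace ℝ (Fin n) → ℂ} (h : IsTestFun n f) :
    Integrable (𝓕 f) := by
  have := (𝓕 (ucSch h)).integrable (μ := volume)
  rwa [SchwartzMap.fourier_coe, ucSch_coe] at this

lemma uc_integrable {n : ℕ} {f : EuclideanSpace ℝ (Fin n) → ℂ} (h : IsTestFun n f) :
    Integrable f := (ucSch h).integrable (μ := volume)

lemma uc_scale (n : ℕ) {s : ℝ} (hs : 0 < s) (F : EuclideanSpace ℝ (Fin n) → ℝ) :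
    ∫ x, (s ^ (-(n : ℝ) / 2)) ^ 2 * F (s⁻¹ • x) = ∫ x, F x := by
  rw [integral_const_mul, Measure.integral_comp_inv_smul_of_nonneg _ _ hs.le,
    finrank_euclideanSpace_fin, smul_eq_mul, ← mul_assoc]
  have : (s ^ (-(n : ℝ) / 2)) ^ 2 * s ^ n = 1 := by
    rw [← Real.rpow_natCast, ← Real.rpow_natCast, ← Real.rpow_mul hs.le, ← Real.rpow_add hs]
    have : -(n : ℝ) / 2 * (2 : ℕ) + n = 0 := by push_cast; ring
    rw [this, Real.rpow_zero]
  rw [this, one_mul]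

lemma uc_sol_sq {n : ℕ} {f : EuclideanSpace ℝ (Fin n) → ℂ} (h : IsTestFun n f) {T : ℝ} (hT : 0 < T)
    (x : EuclideanSpace ℝ (Fin n)) :
    ‖schrodingerSol n f T x‖ ^ 2 = ((4 * π * T) ^ (-(n : ℝ) / 2)) ^ 2 *
      ‖𝓕 (ucChirp n f T) ((4 * π * T)⁻¹ • x)‖ ^ 2 := by
  rw [uc_norm_sol n (uc_integrable h) (uc_integrable_hat h) hT, mul_pow]

lemma uc_sol_int {n : ℕ} {f : EuclideanSpace ℝ (Fin n) → ℂ} (h : IsTestFun n f) {T : ℝ} (hT : 0 < T) :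
    Integrable (fun x => ‖schrodingerSol n f T x‖ ^ 2) ∧
    Integrable (fun x => ‖x‖ ^ 2 * ‖schrodingerSol n f T x‖ ^ 2) := by
  have hs : 0 < 4 * π * T := by positivity
  have h0 := uc_schwartz_int0 n (𝓕 (ucSch (uc_chirp_test h T)))
  have h2 := uc_schwartz_int2 n (𝓕 (ucSch (uc_chirp_test h T)))
  rw [SchwartzMap.fourier_coe, ucSch_coe] at h0 h2
  constructor
  · simp_rw [uc_sol_sq h hT]
    exact (h0.comp_smul (inv_ne_zero hs.ne')).const_mul _
  · simp_rw [uc_sol_sq h hT]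
    have := ((h2.comp_smul (inv_ne_zero hs.ne')).const_mul
      (((4 * π * T) ^ (-(n : ℝ) / 2)) ^ 2 * (4 * π * T) ^ 2))
    refine this.congr (Eventually.of_forall fun x => ?_)
    simp only [norm_smul, norm_inv, Real.norm_of_nonneg hs.le]
    field_simp

lemma uc_conserve {n : ℕ} {f : EuclideanSpace ℝ (Fin n) → ℂ} (h : IsTestFun n f) {T : ℝ}
    (hT : 0 < T) :
    ∫ x, ‖schrodingerSol n f T x‖ ^ 2 = ∫ x, ‖f x‖ ^ 2 := by
  have hs : 0 < 4 * π * T := by positivity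
  simp_rw [uc_sol_sq h hT]
  rw [uc_scale n hs (fun w => ‖𝓕 (ucChirp n f T) w‖ ^ 2)]
  have := SchwartzMap.integral_norm_sq_fourier (ucSch (uc_chirp_test h T))
  rw [SchwartzMap.fourier_coe, ucSch_coe] at this
  rw [this]
  congr 1
  ext x
  rw [ucChirp, norm_mul, mul_comm Complex.I, Complex.norm_exp_ofReal_mul_I, one_mul]

lemma uc_fderiv_chirp {n : ℕ} {f : EuclideanSpace ℝ (Fin n) → ℂ} (h : IsTestFun n f) {T : ℝ}
    (hT : 0 < T) (y : EuclideanSpace ℝ (Fin n)) (j : Fin n) :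
    4 * T ^ 2 * ‖fderiv ℝ (ucChirp n f T) y (EuclideanSpace.single j 1)‖ ^ 2 ≤
      8 * T ^ 2 * ‖fderiv ℝ f y (EuclideanSpace.single j 1)‖ ^ 2 + 2 * ((y j) ^ 2 * ‖f y‖ ^ 2) := by
  have hf : DifferentiableAt ℝ f y := (h.1.differentiable (by simp)) y
  have hq : HasFDerivAt (fun y : EuclideanSpace ℝ (Fin n) => ‖y‖ ^ 2 / (4 * T))
      ((4 * T)⁻¹ • (2 • (innerSL ℝ y))) y := by
    have := (hasStrictFDerivAt_norm_sq y).hasFDerivAt.mul_const ((4 * T)⁻¹)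
    simpa [div_eq_mul_inv] using! this
  have he := ((Complex.ofRealCLM.hasFDerivAt.comp y hq).const_mul Complex.I).cexp
  have hd := he.mul hf.hasFDerivAt
  have e1 : fderiv ℝ (ucChirp n f T) y = _ := hd.fderiv
  rw [e1]
  have e2 : ∀ E q a b : ℂ, ‖E‖ = 1 → 4 * T ^ 2 * ‖E * a + b * (E * q)‖ ^ 2 ≤
      8 * T ^ 2 * ‖a‖ ^ 2 + 2 * ((2 * T * ‖q‖) ^ 2 * ‖b‖ ^ 2) := by
    intro E q a b hE
    have h1 : ‖E * a + b * (E * q)‖ ≤ ‖a‖ + ‖b‖ * ‖q‖ := by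
      refine (norm_add_le _ _).trans ?_
      simp [hE]
    have h2 : ‖E * a + b * (E * q)‖ ^ 2 ≤ 2 * ‖a‖ ^ 2 + 2 * (‖b‖ * ‖q‖) ^ 2 := by
      nlinarith [norm_nonneg (E * a + b * (E * q)), norm_nonneg a,
        mul_nonneg (norm_nonneg b) (norm_nonneg q), sq_nonneg (‖a‖ - ‖b‖ * ‖q‖)]
    nlinarith [sq_nonneg T]
  have hE : ‖Complex.exp (Complex.I * ((‖y‖ ^ 2 / (4 * T) : ℝ) : ℂ))‖ = 1 := by
    rw [mul_comm Complex.I, Complex.norm_exp_ofReal_mul_I]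
  have := e2 (Complex.exp (Complex.I * ((‖y‖ ^ 2 / (4 * T) : ℝ) : ℂ)))
    (Complex.I * (((4 * T)⁻¹ * (2 * y j) : ℝ) : ℂ)) (fderiv ℝ f y (EuclideanSpace.single j 1))
    (f y) hE
  have e3 : (2 * T * ‖Complex.I * (((4 * T)⁻¹ * (2 * y j) : ℝ) : ℂ)‖) ^ 2 = (y j) ^ 2 := by
    rw [norm_mul, Complex.norm_I, one_mul, Complex.norm_real, Real.norm_eq_abs, mul_pow, sq_abs]
    field_simp
    try ring
  rw [e3] at this
  convert! this using 4
  simp [uc_inner_single]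

lemma uc_moment {n : ℕ} {f : EuclideanSpace ℝ (Fin n) → ℂ} (h : IsTestFun n f) {T : ℝ}
    (hT : 0 < T) :
    ∫ x, ‖x‖ ^ 2 * ‖schrodingerSol n f T x‖ ^ 2 ≤
      8 * T ^ 2 * (∫ w, (2 * π) ^ 2 * (‖w‖ ^ 2 * ‖𝓕 f w‖ ^ 2)) + 2 * ∫ y, ‖y‖ ^ 2 * ‖f y‖ ^ 2 := by
  have hs : 0 < 4 * π * T := by positivity
  have hv := uc_chirp_test h T
  have e1 : ∫ x, ‖x‖ ^ 2 * ‖schrodingerSol n f T x‖ ^ 2 =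
      4 * T ^ 2 * ∫ w, (2 * π) ^ 2 * (‖w‖ ^ 2 * ‖𝓕 (ucChirp n f T) w‖ ^ 2) := by
    rw [← integral_const_mul, ← uc_scale n hs (fun w => 4 * T ^ 2 *
      ((2 * π) ^ 2 * (‖w‖ ^ 2 * ‖𝓕 (ucChirp n f T) w‖ ^ 2)))]
    congr 1
    ext x
    rw [uc_sol_sq h hT, norm_smul, norm_inv, Real.norm_of_nonneg hs.le]
    field_simp
    ring
  have e2 := uc_grad n (ucSch hv)
  have e3 := uc_grad n (ucSch h)
  rw [ucSch_coe] at e2 e3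
  rw [e1, e2, e3]
  have hJnt : ∀ {g : EuclideanSpace ℝ (Fin n) → ℂ} (hg : IsTestFun n g) (j : Fin n),
      Integrable (fun y => ‖fderiv ℝ g y (EuclideanSpace.single j 1)‖ ^ 2) := by
    intro g hg j
    have := uc_schwartz_int0 n (∂_{EuclideanSpace.single j (1 : ℝ)} (ucSch hg))
    simpa only [SchwartzMap.lineDerivOp_apply_eq_fderiv, ucSch_coe] using this
  have hJnt2 : ∀ j : Fin n, Integrable (fun y => (y j) ^ 2 * ‖f y‖ ^ 2) := by
    intro j
    have h2 := uc_schwartz_int2 n (ucSch h)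
    rw [ucSch_coe] at h2
    refine h2.mono' ?_ ?_
    · have := h.1.continuous
      exact Continuous.aestronglyMeasurable (by fun_prop)
    · filter_upwards with w
      rw [Real.norm_of_nonneg (by positivity)]
      apply mul_le_mul_of_nonneg_right _ (by positivity)
      rw [EuclideanSpace.norm_sq_eq]
      have := Finset.single_le_sum (f := fun i => ‖w i‖ ^ 2) (fun i _ => by positivity)
        (Finset.mem_univ j)
      simpa using this
  have e4 : ∫ y, ‖y‖ ^ 2 * ‖f y‖ ^ 2 = ∑ j, ∫ y, (y j) ^ 2 * ‖f y‖ ^ 2 := by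
    rw [← integral_finsetSum _ (fun j _ => hJnt2 j)]
    congr 1
    ext w
    rw [← Finset.sum_mul, EuclideanSpace.norm_sq_eq]
    simp
  rw [e4, Finset.mul_sum, Finset.mul_sum, Finset.mul_sum, ← Finset.sum_add_distrib]
  apply Finset.sum_le_sum
  intro j _
  rw [← integral_const_mul, ← integral_const_mul, ← integral_const_mul, ← integral_add]
  · apply integral_mono
    · exact (hJnt hv j).const_mul _
    · exact ((hJnt h j).const_mul _).add ((hJnt2 j).const_mul _)
    · intro y
      exact uc_fderiv_chirp h hT y j
  · exact (hJnt h j).const_mul _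
  · exact (hJnt2 j).const_mul _

lemma uc_sobolev {n : ℕ} {f : EuclideanSpace ℝ (Fin n) → ℂ} (h : IsTestFun n f) :
    ∫ w, (2 * π) ^ 2 * (‖w‖ ^ 2 * ‖𝓕 f w‖ ^ 2) ≤
      ∫ ξ, (1 + ‖ξ‖ ^ 2) ^ (n + 3) * ‖fourierTransformPaper n f ξ‖ ^ 2 := by
  have h2 : (0 : ℝ) < 2 * π := by positivity
  have e1 : ∫ ξ, (1 + ‖ξ‖ ^ 2) ^ (n + 3) * ‖fourierTransformPaper n f ξ‖ ^ 2 =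
      ∫ w, (1 + (2 * π) ^ 2 * ‖w‖ ^ 2) ^ (n + 3) * ‖𝓕 f w‖ ^ 2 := by
    rw [← uc_scale n h2 (fun w => (1 + (2 * π) ^ 2 * ‖w‖ ^ 2) ^ (n + 3) * ‖𝓕 f w‖ ^ 2)]
    congr 1
    ext ξ
    rw [uc_hat_eq, norm_mul, Complex.norm_real, Real.norm_of_nonneg (by positivity), norm_smul,
      norm_inv, Real.norm_of_nonneg h2.le]
    have : (2 * π) ^ 2 * ((2 * π)⁻¹ * ‖ξ‖) ^ 2 = ‖ξ‖ ^ 2 := by field_simp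
    rw [this]
    ring
  rw [e1]
  have i1 := uc_schwartz_int2 n (𝓕 (ucSch h))
  have i2 := uc_schwartz_int n (𝓕 (ucSch h)) (n + 3)
  have hc := (𝓕 (ucSch h)).continuous
  rw [SchwartzMap.fourier_coe, ucSch_coe] at i1 i2 hc
  apply integral_mono
  · exact i1.const_mul _
  · refine (i2.const_mul (((2 * π) ^ 2) ^ (n + 3))).mono' ?_ ?_
    · exact Continuous.aestronglyMeasurable (by fun_prop)
    · filter_upwards with w
      rw [Real.norm_of_nonneg (by positivity), ← mul_assoc, ← mul_pow ((2 * π) ^ 2)]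
      gcongr
      have : (1 : ℝ) ≤ (2 * π) ^ 2 := by nlinarith [Real.pi_gt_three]
      nlinarith
  · intro w
    simp only
    rw [← mul_assoc]
    apply mul_le_mul_of_nonneg_right _ (by positivity)
    have h0 : 0 ≤ (2 * π) ^ 2 * ‖w‖ ^ 2 := by positivity
    calc (2 * π) ^ 2 * ‖w‖ ^ 2 ≤ 1 + (2 * π) ^ 2 * ‖w‖ ^ 2 := by linarith
      _ ≤ _ := le_self_pow₀ (by linarith) (by omega)

lemma uc_weight_int {n : ℕ} {f : EuclideanSpace ℝ (Fin n) → ℂ} (h : IsTestFun n f) (a : ℝ) :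
    Integrable (fun x => Real.exp (a * ‖x‖) * ‖f x‖ ^ 2) := by
  have := h.1.continuous
  apply Continuous.integrable_of_hasCompactSupport (by fun_prop)
  apply HasCompactSupport.mul_left
  exact h.2.norm.comp_left (g := fun t : ℝ => t ^ 2) (by simp)

lemma uc_weight {n : ℕ} {f : EuclideanSpace ℝ (Fin n) → ℂ} (h : IsTestFun n f) {a : ℝ}
    (ha : 0 < a) :
    ∫ y, ‖y‖ ^ 2 * ‖f y‖ ^ 2 ≤ 2 / a ^ 2 * ∫ x, Real.exp (a * ‖x‖) * ‖f x‖ ^ 2 := by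
  rw [← integral_const_mul]
  apply integral_mono
  · exact uc_schwartz_int2 n (ucSch h)
  · exact (uc_weight_int h a).const_mul _
  · intro y
    simp only
    rw [← mul_assoc]
    apply mul_le_mul_of_nonneg_right _ (by positivity)
    have := Real.quadratic_le_exp_of_nonneg (x := a * ‖y‖) (by positivity)
    have h0 : 0 ≤ a * ‖y‖ := by positivity
    have h3 : (a * ‖y‖) ^ 2 / 2 ≤ Real.exp (a * ‖y‖) := by linarith
    calc ‖y‖ ^ 2 = 2 / a ^ 2 * ((a * ‖y‖) ^ 2 / 2) := by field_simp
      _ ≤ _ := by gcongr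

/-- Decay of the solution away from a large ball. -/
lemma uc_tail {n : ℕ} {f : EuclideanSpace ℝ (Fin n) → ℂ} (h : IsTestFun n f) {a T ρ R : ℝ}
    (ha : 0 < a) (hT : 0 < T) (hρ : 0 < ρ) (hρa : ρ ≤ a * T) (hR : 0 < R) :
    ∫ x in (closedBall 0 R)ᶜ, ‖schrodingerSol n f T x‖ ^ 2 ≤
      R⁻¹ ^ 2 * (T ^ 2 * (8 + 4 / ρ ^ 2)) * ((∫ x, Real.exp (a * ‖x‖) * ‖f x‖ ^ 2) +
        ∫ ξ, (1 + ‖ξ‖ ^ 2) ^ (n + 3) * ‖fourierTransformPaper n f ξ‖ ^ 2) := by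
  obtain ⟨i0, i2⟩ := uc_sol_int h hT
  set M := ∫ x, Real.exp (a * ‖x‖) * ‖f x‖ ^ 2 with hM
  set H := ∫ ξ, (1 + ‖ξ‖ ^ 2) ^ (n + 3) * ‖fourierTransformPaper n f ξ‖ ^ 2 with hH
  have hM0 : 0 ≤ M := integral_nonneg fun x => by positivity
  have hH0 : 0 ≤ H := integral_nonneg fun x => by positivity
  have h1 : ∫ x in (closedBall 0 R)ᶜ, ‖schrodingerSol n f T x‖ ^ 2 ≤
      ∫ x in (closedBall 0 R)ᶜ, R⁻¹ ^ 2 * (‖x‖ ^ 2 * ‖schrodingerSol n f T x‖ ^ 2) := by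
    apply setIntegral_mono_on i0.integrableOn (i2.const_mul _).integrableOn
      measurableSet_closedBall.compl
    intro x hx
    simp only [Set.mem_compl_iff, mem_closedBall, dist_zero_right, not_le] at hx
    rw [← mul_assoc, ← mul_pow]
    have : 1 ≤ R⁻¹ * ‖x‖ := by
      rw [inv_mul_eq_div, le_div_iff₀ hR]; linarith
    exact le_mul_of_one_le_left (by positivity) (one_le_pow₀ this)
  have h2 : ∫ x in (closedBall 0 R)ᶜ, R⁻¹ ^ 2 * (‖x‖ ^ 2 * ‖schrodingerSol n f T x‖ ^ 2) ≤
      ∫ x, R⁻¹ ^ 2 * (‖x‖ ^ 2 * ‖schrodingerSol n f T x‖ ^ 2) :=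
    setIntegral_le_integral (i2.const_mul _) (Eventually.of_forall fun x => by positivity)
  rw [integral_const_mul (μ := volume)] at h2
  have h3 := uc_moment h hT
  have h4 := uc_sobolev h
  have h5 := uc_weight h ha
  rw [← hH] at h4
  rw [← hM] at h5
  have h6 : 2 / a ^ 2 ≤ 2 * T ^ 2 / ρ ^ 2 := by
    rw [div_le_div_iff₀ (by positivity) (by positivity)]
    have : ρ ^ 2 ≤ (a * T) ^ 2 := by gcongr
    nlinarith
  have h7 : ∫ x, ‖x‖ ^ 2 * ‖schrodingerSol n f T x‖ ^ 2 ≤ T ^ 2 * (8 + 4 / ρ ^ 2) * (M + H) := by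
    calc _ ≤ 8 * T ^ 2 * H + 2 * (2 * T ^ 2 / ρ ^ 2 * M) := by
          refine h3.trans ?_
          gcongr
          refine h5.trans ?_
          gcongr
      _ ≤ (8 * T ^ 2 * H + 2 * (2 * T ^ 2 / ρ ^ 2 * M)) +
          (8 * T ^ 2 * M + 2 * (2 * T ^ 2 / ρ ^ 2 * H)) := by
          have : 0 ≤ 8 * T ^ 2 * M + 2 * (2 * T ^ 2 / ρ ^ 2 * H) := by positivity
          linarith
      _ = _ := by ring
  calc _ ≤ R⁻¹ ^ 2 * (T ^ 2 * (8 + 4 / ρ ^ 2) * (M + H)) := by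
        refine (h1.trans h2).trans ?_
        gcongr
    _ = _ := by ring

end UCPlancherel

section UCAnalytic
open scoped FourierTransform

/-- The complexified Fourier integral along a line. -/
noncomputable def ucLine (n : ℕ) (v : EuclideanSpace ℝ (Fin n) → ℂ) (c e : EuclideanSpace ℝ (Fin n))
    (z : ℂ) : ℂ :=
  ∫ y, Complex.exp (-2 * π * Complex.I * ((⟪y, c⟫ : ℝ) + z * (⟪y, e⟫ : ℝ))) * v y

lemma uc_line_diff {n : ℕ} {v : EuclideanSpace ℝ (Fin n) → ℂ} (hv : Continuous v)
    (hs : HasCompactSupport v) (c e : EuclideanSpace ℝ (Fin n)) :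
    Differentiable ℂ (ucLine n v c e) := by
  intro z₀
  set F : ℂ → EuclideanSpace ℝ (Fin n) → ℂ := fun z y =>
    Complex.exp (-2 * π * Complex.I * ((⟪y, c⟫ : ℝ) + z * (⟪y, e⟫ : ℝ))) * v y with hF
  set F' : ℂ → EuclideanSpace ℝ (Fin n) → ℂ := fun z y =>
    Complex.exp (-2 * π * Complex.I * ((⟪y, c⟫ : ℝ) + z * (⟪y, e⟫ : ℝ))) *
      (-2 * π * Complex.I * (⟪y, e⟫ : ℝ)) * v y with hF'
  have hd : ∀ z y, HasDerivAt (fun z => F z y) (F' z y) z := by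
    intro z y
    have h1 : HasDerivAt (fun z : ℂ => -2 * π * Complex.I * ((⟪y, c⟫ : ℝ) + z * (⟪y, e⟫ : ℝ)))
        (-2 * π * Complex.I * (⟪y, e⟫ : ℝ)) z := by
      have := (((hasDerivAt_id z).mul_const ((⟪y, e⟫ : ℝ) : ℂ)).const_add
        ((⟪y, c⟫ : ℝ) : ℂ)).const_mul (-2 * π * Complex.I)
      simpa using this
    exact h1.cexp.mul_const _
  have hFc : ∀ z, Continuous (F z) := fun z => by rw [hF]; fun_prop
  have hF'c : ∀ z, Continuous (F' z) := fun z => by rw [hF']; fun_prop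
  have hbd : ∀ z ∈ ball z₀ 1, ∀ y, ‖F' z y‖ ≤
      Real.exp (2 * π * ((|z₀.im| + 1) * |⟪y, e⟫|)) * (2 * π * |⟪y, e⟫|) * ‖v y‖ := by
    intro z hz y
    rw [hF']
    simp only [norm_mul, Complex.norm_exp, Complex.norm_real, Complex.norm_I, norm_neg,
      Real.norm_eq_abs, mul_one]
    rw [abs_of_pos Real.pi_pos]
    have h1 : |z.im| ≤ |z₀.im| + 1 := by
      rw [mem_ball, dist_eq_norm] at hz
      have h2 := Complex.abs_im_le_norm (z - z₀)
      rw [Complex.sub_im] at h2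
      have h3 := abs_sub_abs_le_abs_sub z.im z₀.im
      linarith
    have h2 : (-2 * π * Complex.I * ((⟪y, c⟫ : ℝ) + z * (⟪y, e⟫ : ℝ)) : ℂ).re =
        2 * π * (z.im * ⟪y, e⟫) := by
      simp
      try ring
    rw [h2]
    have h3 : z.im * ⟪y, e⟫ ≤ (|z₀.im| + 1) * |⟪y, e⟫| := by
      calc z.im * ⟪y, e⟫ ≤ |z.im * ⟪y, e⟫| := le_abs_self _
        _ = |z.im| * |⟪y, e⟫| := abs_mul _ _
        _ ≤ _ := by gcongr
    have h4 : ‖(2 : ℂ)‖ = 2 := by simp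
    rw [h4]
    gcongr
  have key := hasDerivAt_integral_of_dominated_loc_of_deriv_le (μ := volume) (F := F) (F' := F')
    (x₀ := z₀) (s := ball z₀ 1)
    (bound := fun y => Real.exp (2 * π * ((|z₀.im| + 1) * |⟪y, e⟫|)) * (2 * π * |⟪y, e⟫|) * ‖v y‖)
    (ball_mem_nhds z₀ one_pos)
    (Eventually.of_forall fun z => (hFc z).aestronglyMeasurable)
    ((hFc z₀).integrable_of_hasCompactSupport hs.mul_left)
    (hF'c z₀).aestronglyMeasurable
    (Eventually.of_forall fun y z hz => hbd z hz y)
    (Continuous.integrable_of_hasCompactSupport (by fun_prop) hs.norm.mul_left)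
    (Eventually.of_forall fun y z _ => hd z y)
  exact key.2.differentiableAt

lemma uc_line_real {n : ℕ} (v : EuclideanSpace ℝ (Fin n) → ℂ)
    (c e : EuclideanSpace ℝ (Fin n)) (t : ℝ) : ucLine n v c e t = 𝓕 v (c + t • e) := by
  rw [ucLine, Real.fourier_eq']
  congr 1
  ext y
  rw [smul_eq_mul, inner_add_right, inner_smul_right]
  congr 2
  push_cast
  ring

lemma uc_line_bound {n : ℕ} {v : EuclideanSpace ℝ (Fin n) → ℂ} (hv : Continuous v)
    (hs : HasCompactSupport v) (c e : EuclideanSpace ℝ (Fin n)) {z : ℂ} {b : ℝ}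
    (hz : 2 * π * (|z.im| * ‖e‖) ≤ b) :
    ‖ucLine n v c e z‖ ≤ ∫ y, Real.exp (b * ‖y‖) * ‖v y‖ := by
  rw [ucLine]
  apply norm_integral_le_of_norm_le
  · exact Continuous.integrable_of_hasCompactSupport (by fun_prop) hs.norm.mul_left
  · filter_upwards with y
    rw [norm_mul, Complex.norm_exp]
    have h2 : (-2 * π * Complex.I * ((⟪y, c⟫ : ℝ) + z * (⟪y, e⟫ : ℝ)) : ℂ).re =
        2 * π * (z.im * ⟪y, e⟫) := by
      simp
      try ring
    rw [h2]
    apply mul_le_mul_of_nonneg_right _ (norm_nonneg _)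
    apply Real.exp_le_exp.2
    have h3 : z.im * ⟪y, e⟫ ≤ |z.im| * (‖y‖ * ‖e‖) := by
      calc z.im * ⟪y, e⟫ ≤ |z.im * ⟪y, e⟫| := le_abs_self _
        _ = |z.im| * |⟪y, e⟫| := abs_mul _ _
        _ ≤ _ := by gcongr; exact abs_real_inner_le_norm y e
    calc 2 * π * (z.im * ⟪y, e⟫) ≤ 2 * π * (|z.im| * (‖y‖ * ‖e‖)) := by gcongr
      _ = (2 * π * (|z.im| * ‖e‖)) * ‖y‖ := by ring
      _ ≤ _ := by gcongr

lemma uc_lip {n : ℕ} {v : EuclideanSpace ℝ (Fin n) → ℂ} (hv : Continuous v)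
    (hs : HasCompactSupport v) {b : ℝ} (hb : 0 < b) (p q : EuclideanSpace ℝ (Fin n)) :
    ‖𝓕 v p - 𝓕 v q‖ ≤ (2 * π / b * ‖p - q‖) * ∫ y, Real.exp (b * ‖y‖) * ‖v y‖ := by
  have hi : ∀ p : EuclideanSpace ℝ (Fin n), Integrable (fun y : EuclideanSpace ℝ (Fin n) =>
      Complex.exp (↑(-2 * π * ⟪y, p⟫) * Complex.I) • v y) := by
    intro p
    simp only [smul_eq_mul]
    exact Continuous.integrable_of_hasCompactSupport (by fun_prop) hs.mul_left
  rw [Real.fourier_eq', Real.fourier_eq', ← integral_sub (hi p) (hi q), ← integral_const_mul]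
  · apply norm_integral_le_of_norm_le
    · exact Continuous.integrable_of_hasCompactSupport (by fun_prop) hs.norm.mul_left.mul_left
    · filter_upwards with y
      rw [← sub_smul, norm_smul]
      have h1 : ‖Complex.exp (↑(-2 * π * ⟪y, p⟫) * Complex.I) -
          Complex.exp (↑(-2 * π * ⟪y, q⟫) * Complex.I)‖ ≤ 2 * π * (‖y‖ * ‖p - q‖) := by
        have e1 : Complex.exp (↑(-2 * π * ⟪y, p⟫) * Complex.I) -
          Complex.exp (↑(-2 * π * ⟪y, q⟫) * Complex.I) =
          Complex.exp (↑(-2 * π * ⟪y, q⟫) * Complex.I) *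
            (Complex.exp (Complex.I * ((-2 * π * ⟪y, p - q⟫ : ℝ) : ℂ)) - 1) := by
          rw [mul_sub, ← Complex.exp_add, inner_sub_right, mul_one]
          congr 2
          push_cast; ring
        rw [e1, norm_mul, Complex.norm_exp_ofReal_mul_I, one_mul]
        refine (Real.norm_exp_I_mul_ofReal_sub_one_le).trans ?_
        rw [Real.norm_eq_abs, abs_mul, abs_mul, abs_neg, abs_two, abs_of_pos Real.pi_pos]
        gcongr
        exact abs_real_inner_le_norm _ _
      have h2 : b * ‖y‖ ≤ Real.exp (b * ‖y‖) := by linarith [Real.add_one_le_exp (b * ‖y‖)]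
      have h3 : 2 * π * (‖y‖ * ‖p - q‖) = 2 * π / b * ‖p - q‖ * (b * ‖y‖) := by field_simp
      have h4 : 2 * π / b * ‖p - q‖ * (b * ‖y‖) ≤ 2 * π / b * ‖p - q‖ * Real.exp (b * ‖y‖) :=
        mul_le_mul_of_nonneg_left h2 (by positivity)
      have h5 := (h1.trans h3.le).trans h4
      have h6 := mul_le_mul_of_nonneg_right h5 (norm_nonneg (v y))
      rw [mul_assoc _ (Real.exp _)] at h6
      exact h6

lemma uc_exp_int (n : ℕ) : Integrable (fun y : EuclideanSpace ℝ (Fin n) => Real.exp (-‖y‖)) := by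
  have h := integrable_one_add_norm (E := EuclideanSpace ℝ (Fin n)) (μ := volume)
    (r := n + 1) (by simp)
  refine (h.const_mul ((n + 1).factorial * Real.exp 1)).mono' ?_ ?_
  · exact Continuous.aestronglyMeasurable (by fun_prop)
  · filter_upwards with y
    rw [Real.norm_of_nonneg (Real.exp_pos _).le]
    have h1 := Real.pow_div_factorial_le_exp (1 + ‖y‖) (by positivity) (n + 1)
    have h2 : (1 + ‖y‖) ^ (-((n : ℝ) + 1)) = ((1 + ‖y‖) ^ (n + 1))⁻¹ := by
      rw [Real.rpow_neg (by positivity)]; norm_cast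
    rw [h2]
    have h3 : 0 < (1 + ‖y‖) ^ (n + 1) := by positivity
    rw [div_le_iff₀ (by positivity), Real.exp_add] at h1
    rw [← div_eq_mul_inv, le_div_iff₀ h3]
    calc Real.exp (-‖y‖) * (1 + ‖y‖) ^ (n + 1)
        ≤ Real.exp (-‖y‖) * (Real.exp 1 * Real.exp ‖y‖ * (n + 1).factorial) := by gcongr
      _ = (Real.exp (-‖y‖) * Real.exp ‖y‖) * (Real.exp 1 * (n + 1).factorial) := by ring
      _ = _ := by rw [← Real.exp_add]; simp; ring

/-- Weighted Cauchy-Schwarz. -/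
lemma uc_cs {n : ℕ} {f : EuclideanSpace ℝ (Fin n) → ℂ} (h : IsTestFun n f) {a : ℝ} (ha : 0 < a) :
    (∫ y, Real.exp (a / 4 * ‖y‖) * ‖f y‖) ^ 2 ≤
      (2 / a) ^ n * (∫ y : EuclideanSpace ℝ (Fin n), Real.exp (-‖y‖)) *
        ∫ x, Real.exp (a * ‖x‖) * ‖f x‖ ^ 2 := by
  have hfc := h.1.continuous
  set g1 : EuclideanSpace ℝ (Fin n) → ℝ := fun y => Real.exp (-(a / 4 * ‖y‖)) with hg1
  set g2 : EuclideanSpace ℝ (Fin n) → ℝ := fun y => Real.exp (a / 2 * ‖y‖) * ‖f y‖ with hg2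
  have s1 : ∀ y, g1 y ^ 2 = Real.exp (-‖(a / 2) • y‖) := by
    intro y
    rw [hg1, ← Real.exp_nat_mul, norm_smul, Real.norm_of_nonneg (by positivity)]
    congr 1; push_cast; ring
  have s2 : ∀ y, g2 y ^ 2 = Real.exp (a * ‖y‖) * ‖f y‖ ^ 2 := by
    intro y
    rw [hg2]; simp only
    rw [mul_pow, ← Real.exp_nat_mul]
    congr 2; push_cast; ring
  have i1 : Integrable (fun y => g1 y ^ 2) := by
    simp_rw [s1]
    exact (uc_exp_int n).comp_smul (R := a / 2) (by positivity)
  have i2 : Integrable (fun y => g2 y ^ 2) := by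
    simp_rw [s2]
    exact uc_weight_int h a
  have m1 : MemLp g1 2 := (memLp_two_iff_integrable_sq
    (Continuous.aestronglyMeasurable (by rw [hg1]; fun_prop))).2 i1
  have m2 : MemLp g2 2 := (memLp_two_iff_integrable_sq
    (Continuous.aestronglyMeasurable (by rw [hg2]; fun_prop))).2 i2
  have key := integral_mul_le_Lp_mul_Lq_of_nonneg (μ := volume) (f := g1) (g := g2)
    Real.HolderConjugate.two_two
    (Eventually.of_forall fun y => (Real.exp_pos _).le)
    (Eventually.of_forall fun y => by rw [hg2]; simp only [Pi.zero_apply]; positivity)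
    (by simpa using m1) (by simpa using m2)
  have e0 : ∀ y, g1 y * g2 y = Real.exp (a / 4 * ‖y‖) * ‖f y‖ := by
    intro y
    rw [hg1, hg2]; simp only
    rw [← mul_assoc, ← Real.exp_add]
    congr 2; ring
  simp_rw [e0, Real.rpow_two] at key
  rw [← Real.sqrt_eq_rpow, ← Real.sqrt_eq_rpow] at key
  have p0 : 0 ≤ ∫ y, Real.exp (a / 4 * ‖y‖) * ‖f y‖ := integral_nonneg fun y => by positivity
  have p1 : 0 ≤ ∫ y, g1 y ^ 2 := integral_nonneg fun y => by positivity
  have p2 : 0 ≤ ∫ y, g2 y ^ 2 := integral_nonneg fun y => by positivity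
  have e1 : ∫ y, g1 y ^ 2 = (2 / a) ^ n * ∫ y : EuclideanSpace ℝ (Fin n), Real.exp (-‖y‖) := by
    simp_rw [s1]
    rw [Measure.integral_comp_smul_of_nonneg volume
      (fun y : EuclideanSpace ℝ (Fin n) => Real.exp (-‖y‖)) (a / 2) (hR := by positivity),
      finrank_euclideanSpace_fin, smul_eq_mul, ← inv_pow, inv_div]
  have e2 : ∫ y, g2 y ^ 2 = ∫ x, Real.exp (a * ‖x‖) * ‖f x‖ ^ 2 := by simp_rw [s2]
  rw [← e1, ← e2]
  calc _ ≤ (√(∫ y, g1 y ^ 2) * √(∫ y, g2 y ^ 2)) ^ 2 := by gcongr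
    _ = _ := by rw [mul_pow, Real.sq_sqrt p1, Real.sq_sqrt p2]

end UCAnalytic

section UCCombine
open scoped FourierTransform

noncomputable def ucA (n : ℕ) : ℝ := 2 ^ n * ∫ y : EuclideanSpace ℝ (Fin n), Real.exp (-‖y‖)

noncomputable def ucW (n : ℕ) : ℝ := volume.real (closedBall (0 : EuclideanSpace ℝ (Fin n)) 1)

lemma ucA_pos (n : ℕ) : 0 < ucA n := by
  have := integral_exp_pos (uc_exp_int n)
  unfold ucA
  positivity

lemma ucW_pos (n : ℕ) : 0 < ucW n := by
  unfold ucW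
  exact ENNReal.toReal_pos (measure_closedBall_pos volume _ one_pos).ne'
    (isCompact_closedBall _ _).measure_lt_top.ne

lemma uc_norm_chirp (n : ℕ) (f : EuclideanSpace ℝ (Fin n) → ℂ) (T : ℝ)
    (y : EuclideanSpace ℝ (Fin n)) : ‖ucChirp n f T y‖ = ‖f y‖ := by
  rw [ucChirp, norm_mul, Complex.norm_exp_I_mul_ofReal, one_mul]

lemma uc_kappa {n : ℕ} {f : EuclideanSpace ℝ (Fin n) → ℂ} (h : IsTestFun n f) {a T ρ : ℝ}
    (ha : 0 < a) (hT : 0 < T) (hρ : 0 < ρ) (hρa : ρ ≤ a * T) :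
    (4 * π * T) ^ (-(n : ℝ) / 2) * (∫ y, Real.exp (a / 4 * ‖y‖) * ‖ucChirp n f T y‖) ≤
      √(ucA n * ρ⁻¹ ^ n * ∫ x, Real.exp (a * ‖x‖) * ‖f x‖ ^ 2) := by
  simp_rw [uc_norm_chirp]
  apply Real.le_sqrt_of_sq_le
  have hs : 0 < 4 * π * T := by positivity
  have k2 : ((4 * π * T) ^ (-(n : ℝ) / 2)) ^ 2 = (4 * π * T)⁻¹ ^ n := by
    rw [← Real.rpow_natCast, ← Real.rpow_mul hs.le]
    have : -(n : ℝ) / 2 * ((2 : ℕ) : ℝ) = -n := by push_cast; ring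
    rw [this, Real.rpow_neg hs.le, Real.rpow_natCast, inv_pow]
  have hM : 0 ≤ ∫ x, Real.exp (a * ‖x‖) * ‖f x‖ ^ 2 := integral_nonneg fun y => by positivity
  have hc : 0 ≤ ∫ y : EuclideanSpace ℝ (Fin n), Real.exp (-‖y‖) :=
    integral_nonneg fun y => by positivity
  rw [mul_pow, k2]
  calc _ ≤ (4 * π * T)⁻¹ ^ n * ((2 / a) ^ n * (∫ y : EuclideanSpace ℝ (Fin n), Real.exp (-‖y‖)) *
        ∫ x, Real.exp (a * ‖x‖) * ‖f x‖ ^ 2) :=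
        mul_le_mul_of_nonneg_left (uc_cs h ha) (by positivity)
    _ = ((4 * π * T)⁻¹ * (1 / a)) ^ n * (2 ^ n * (∫ y : EuclideanSpace ℝ (Fin n), Real.exp (-‖y‖)) *
        ∫ x, Real.exp (a * ‖x‖) * ‖f x‖ ^ 2) := by
        rw [mul_pow, show 2 / a = (1 / a) * 2 by ring, mul_pow (1 / a) 2]; ring
    _ ≤ ρ⁻¹ ^ n * (2 ^ n * (∫ y : EuclideanSpace ℝ (Fin n), Real.exp (-‖y‖)) *
        ∫ x, Real.exp (a * ‖x‖) * ‖f x‖ ^ 2) := by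
        apply mul_le_mul_of_nonneg_right _ (by positivity)
        apply pow_le_pow_left₀ (by positivity)
        rw [one_div, ← mul_inv]
        apply inv_anti₀ hρ
        have : a * T ≤ (4 * π) * (a * T) := by
          have h1 : 1 ≤ 4 * π := by linarith [Real.pi_gt_three]
          have h2 : 0 < a * T := by positivity
          nlinarith
        linarith
    _ = _ := by rw [ucA]; ring

lemma uc_point {n : ℕ} {f : EuclideanSpace ℝ (Fin n) → ℂ} (h : IsTestFun n f) {a T r ρ : ℝ}
    (ha : 0 < a) (hT : 0 < T) (hρ : 0 < ρ) (hρa : ρ ≤ a * T) (hρr : ρ ≤ r)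
    (hM : 0 < ∫ x, Real.exp (a * ‖x‖) * ‖f x‖ ^ 2)
    (x₀ : EuclideanSpace ℝ (Fin n)) (k : ℕ) (x : EuclideanSpace ℝ (Fin n))
    (hx : x ∈ closedBall x₀ ((k / 2 + 2) * (ρ / 8))) {τ : ℝ} (hτ : 0 < τ) :
    ‖schrodingerSol n f T x‖ ^ 2 ≤ ucA n * ρ⁻¹ ^ n *
      (τ * (∫ x, Real.exp (a * ‖x‖) * ‖f x‖ ^ 2) +
        (τ ^ (2 ^ k * (n + 2)))⁻¹ * (4 ^ (n + 1) / (ucW n * ucA n)) *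
          ∫ y in closedBall x₀ r, ‖schrodingerSol n f T y‖ ^ 2) := by
  set M := ∫ x, Real.exp (a * ‖x‖) * ‖f x‖ ^ 2 with hMdef
  set S := ∫ y in closedBall x₀ r, ‖schrodingerSol n f T y‖ ^ 2 with hSdef
  set v := ucChirp n f T with hv
  have hvt : IsTestFun n v := uc_chirp_test h T
  have hvc := hvt.1.continuous
  have hvs := hvt.2
  have hA := ucA_pos n
  have hW := ucW_pos n
  set s : ℝ := 4 * π * T with hs
  have hs0 : 0 < s := by positivity
  set κ : ℝ := s ^ (-(n : ℝ) / 2) with hκ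
  have hκ0 : 0 < κ := by positivity
  set J := ∫ y, Real.exp (a / 4 * ‖y‖) * ‖v y‖ with hJ
  have hJ0 : 0 ≤ J := integral_nonneg fun y => by positivity
  set B := √(ucA n * ρ⁻¹ ^ n * M) with hB
  have hB0 : 0 < B := Real.sqrt_pos.2 (by positivity)
  have hB2 : B ^ 2 = ucA n * ρ⁻¹ ^ n * M := Real.sq_sqrt (by positivity)
  have hκJ : κ * J ≤ B := uc_kappa h ha hT hρ hρa
  have hκJ1 : κ / B * J ≤ 1 := by
    rw [div_mul_eq_mul_div, div_le_one hB0]; exact hκJ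
  set G : EuclideanSpace ℝ (Fin n) → ℂ := fun x => ((κ / B : ℝ) : ℂ) * 𝓕 v (s⁻¹ • x) with hG
  have hGn : ∀ x, ‖G x‖ = ‖schrodingerSol n f T x‖ / B := by
    intro x
    rw [uc_norm_sol n (uc_integrable h) (uc_integrable_hat h) hT x, hG]
    simp only [norm_mul, Complex.norm_real]
    rw [Real.norm_of_nonneg (by positivity)]
    ring
  have hlb : ∀ c e z, 2 * π * (|z.im| * ‖e‖) ≤ a / 4 →
      ‖((κ / B : ℝ) : ℂ) * ucLine n v c e z‖ ≤ 1 := by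
    intro c e z hz
    rw [norm_mul, Complex.norm_real, Real.norm_of_nonneg (by positivity)]
    refine le_trans ?_ hκJ1
    exact mul_le_mul_of_nonneg_left (uc_line_bound hvc hvs c e hz) (by positivity)
  have hline : ∀ c e, ‖e‖ = 1 → ∃ g : ℂ → ℂ, Differentiable ℂ g ∧
      (∀ t : ℝ, g t = G (c + t • e)) ∧ ∀ z : ℂ, |z.im| ≤ 4 * (ρ / 8) → ‖g z‖ ≤ 1 := by
    intro c e he
    refine ⟨fun z => ((κ / B : ℝ) : ℂ) * ucLine n v (s⁻¹ • c) (s⁻¹ • e) z,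
      (uc_line_diff hvc hvs _ _).const_mul _, ?_, ?_⟩
    · intro t
      simp only [hG]
      rw [uc_line_real, smul_add, smul_comm t]
    · intro z hz
      apply hlb
      rw [norm_smul, he, mul_one, Real.norm_of_nonneg (by positivity)]
      calc 2 * π * (|z.im| * s⁻¹) ≤ 2 * π * ((a * T / 2) * s⁻¹) := by
            gcongr; linarith
        _ = a / 4 := by rw [hs]; field_simp
  have hG1 : ∀ x, ‖G x‖ ≤ 1 := by
    intro x
    have h1 := hlb (s⁻¹ • x) 0 ((0 : ℝ) : ℂ) (by simp; positivity)
    rw [uc_line_real] at h1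
    simpa [hG] using h1
  have hL : ∀ x y, ‖G x - G y‖ ≤ 2 / ρ * ‖x - y‖ := by
    intro x y
    have h1 := uc_lip hvc hvs (b := a / 4) (by positivity) (s⁻¹ • x) (s⁻¹ • y)
    rw [← smul_sub, norm_smul, Real.norm_of_nonneg (by positivity)] at h1
    simp only [hG]
    rw [← mul_sub, norm_mul, Complex.norm_real, Real.norm_of_nonneg (by positivity)]
    calc _ ≤ κ / B * (2 * π / (a / 4) * (s⁻¹ * ‖x - y‖) * J) :=
          mul_le_mul_of_nonneg_left h1 (by positivity)
      _ = (κ / B * J) * (2 / (a * T) * ‖x - y‖) := by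
          rw [hs]; field_simp; try norm_num
      _ ≤ 1 * (2 / (a * T) * ‖x - y‖) := by gcongr
      _ ≤ _ := by rw [one_mul]; gcongr
  have hS0 : 0 ≤ S := integral_nonneg fun y => by positivity
  have hC0 : 0 ≤ 4 ^ (n + 1) / (ucW n * ucA n) * S / M := by positivity
  have hst : ∀ x ∈ closedBall x₀ (2 * (ρ / 8)), ‖G x‖ ^ (n + 2) ≤
      4 ^ (n + 1) / (ucW n * ucA n) * S / M := by
    intro x hx
    have h1 := uc_start n hρ hρr hG1 hL x₀ x (closedBall_subset_closedBall (by linarith) hx)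
    have h2 : ∫ y in closedBall x₀ r, ‖G y‖ ^ 2 = S / B ^ 2 := by
      simp_rw [hGn, div_pow]
      rw [integral_div]
    rw [h2, hB2] at h1
    change ucW n * _ ≤ _ at h1
    rw [mul_comm, ← le_div_iff₀ hW] at h1
    refine h1.trans (le_of_eq ?_)
    rw [div_pow, inv_pow]
    field_simp
    ring
  set m : ℝ := (4 ^ (n + 1) / (ucW n * ucA n) * S / M) ^ ((n + 2 : ℕ) : ℝ)⁻¹ with hm
  have hm0 : 0 ≤ m := by positivity
  have hmp : m ^ (n + 2) = 4 ^ (n + 1) / (ucW n * ucA n) * S / M :=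
    Real.rpow_inv_natCast_pow hC0 (by omega)
  have hch := uc_chain (δ := ρ / 8) (by positivity) hm0 hline hG1 x₀
    (fun x hx => by
      apply le_of_pow_le_pow_left₀ (n := n + 2) (by omega) hm0
      rw [hmp]; exact hst x hx) k x hx
  have hN : (‖G x‖ ^ 2) ^ (2 ^ k * (n + 2)) ≤ 4 ^ (n + 1) / (ucW n * ucA n) * S / M := by
    rw [← hmp]
    calc (‖G x‖ ^ 2) ^ (2 ^ k * (n + 2)) = ((‖G x‖ ^ 2 ^ k) ^ (n + 2)) ^ 2 := by
          rw [← pow_mul, ← pow_mul, ← pow_mul]; congr 1; ring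
      _ ≤ (‖G x‖ ^ 2 ^ k) ^ (n + 2) := by
          apply pow_le_of_le_one (by positivity) _ (by norm_num)
          exact pow_le_one₀ (by positivity) (pow_le_one₀ (norm_nonneg _) (hG1 x))
      _ ≤ _ := by gcongr
  have hq : ‖G x‖ ^ 2 ≤ τ + (τ ^ (2 ^ k * (n + 2)))⁻¹ *
      (4 ^ (n + 1) / (ucW n * ucA n) * S / M) := by
    rcases le_total (‖G x‖ ^ 2) τ with h1 | h1
    · have : 0 ≤ (τ ^ (2 ^ k * (n + 2)))⁻¹ *
        (4 ^ (n + 1) / (ucW n * ucA n) * S / M) := by positivity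
      linarith
    · have h2 : τ ^ (2 ^ k * (n + 2)) ≤ 4 ^ (n + 1) / (ucW n * ucA n) * S / M :=
        (pow_le_pow_left₀ hτ.le h1 _).trans hN
      have h3 : 1 ≤ (τ ^ (2 ^ k * (n + 2)))⁻¹ *
        (4 ^ (n + 1) / (ucW n * ucA n) * S / M) := by
        rw [inv_mul_eq_div, one_le_div (by positivity)]; exact h2
      have h4 : ‖G x‖ ^ 2 ≤ 1 := pow_le_one₀ (norm_nonneg _) (hG1 x)
      linarith
  rw [hGn, div_pow, div_le_iff₀ (by positivity), hB2] at hq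
  refine hq.trans (le_of_eq ?_)
  field_simp

lemma uc_combine {n : ℕ} {f : EuclideanSpace ℝ (Fin n) → ℂ} (h : IsTestFun n f) {a T r ρ : ℝ}
    (ha : 0 < a) (hT : 0 < T) (hρ : 0 < ρ) (hρa : ρ ≤ a * T) (hρr : ρ ≤ r)
    (hM : 0 < ∫ x, Real.exp (a * ‖x‖) * ‖f x‖ ^ 2)
    (x₀ : EuclideanSpace ℝ (Fin n)) (k : ℕ) {R : ℝ} (hR : 0 < R)
    (hk : R + ‖x₀‖ ≤ (k / 2 + 2) * (ρ / 8)) {τ : ℝ} (hτ : 0 < τ) :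
    ∫ x, ‖f x‖ ^ 2 ≤
      R⁻¹ ^ 2 * (T ^ 2 * (8 + 4 / ρ ^ 2)) * ((∫ x, Real.exp (a * ‖x‖) * ‖f x‖ ^ 2) +
        ∫ ξ, (1 + ‖ξ‖ ^ 2) ^ (n + 3) * ‖fourierTransformPaper n f ξ‖ ^ 2) +
      R ^ n * ucW n * (ucA n * ρ⁻¹ ^ n *
      (τ * (∫ x, Real.exp (a * ‖x‖) * ‖f x‖ ^ 2) +
        (τ ^ (2 ^ k * (n + 2)))⁻¹ * (4 ^ (n + 1) / (ucW n * ucA n)) *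
          ∫ y in closedBall x₀ r, ‖schrodingerSol n f T y‖ ^ 2)) := by
  rw [← uc_conserve h hT]
  have hi := (uc_sol_int h hT).1
  rw [← integral_add_compl (measurableSet_closedBall (x := (0 : EuclideanSpace ℝ (Fin n))) (ε := R))
    hi, add_comm]
  refine add_le_add (uc_tail h ha hT hρ hρa hR) ?_
  refine (setIntegral_mono_on hi.integrableOn
    (integrableOn_const (isCompact_closedBall _ _).measure_lt_top.ne) measurableSet_closedBall
    (fun x hx => uc_point h ha hT hρ hρa hρr hM x₀ k x ?_ hτ)).trans ?_
  · rw [mem_closedBall, dist_eq_norm]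
    rw [mem_closedBall, dist_zero_right] at hx
    exact (norm_sub_le _ _).trans (by linarith)
  · rw [setIntegral_const, smul_eq_mul]
    apply le_of_eq
    congr 1
    rw [ucW, Measure.addHaar_real_closedBall' volume _ hR.le, finrank_euclideanSpace_fin]

end UCCombine

section UCNumerics

lemma uc_num1 {n k : ℕ} {D X : ℝ} (hX : 1 ≤ X) (hD : (2 * n + 39) * (1 + X) ≤ D)
    (hk : (k : ℝ) ≤ 32 * X * D + 1) :
    D ^ (n + 1 + (n + 2) * (2 ^ k * (n + 2))) ≤ Real.exp (Real.exp (D ^ 2)) := by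
  have hn : (0 : ℝ) ≤ n := Nat.cast_nonneg n
  have hD1 : 1 ≤ D := by nlinarith
  have hD0 : 0 < D := by linarith
  rw [← Real.exp_log hD0, ← Real.exp_nat_mul, Real.exp_log hD0]
  apply Real.exp_le_exp.2
  have h2k : (1 : ℝ) ≤ 2 ^ k := one_le_pow₀ (by norm_num)
  have h2e : (2 : ℝ) ≤ Real.exp 1 := by linarith [Real.add_one_le_exp (1 : ℝ)]
  have h1 : ((n + 1 + (n + 2) * (2 ^ k * (n + 2)) : ℕ) : ℝ) ≤ 2 * ((n + 2) ^ 2 * 2 ^ k) := by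
    push_cast
    have : (n + 1 : ℝ) ≤ (n + 2) ^ 2 * 2 ^ k := by
      calc (n + 1 : ℝ) ≤ (n + 2) ^ 2 * 1 := by nlinarith
        _ ≤ _ := by gcongr
    nlinarith
  have h2 : (2 : ℝ) ^ k ≤ Real.exp k := by
    calc (2 : ℝ) ^ k ≤ Real.exp 1 ^ k := by gcongr
      _ = _ := by rw [← Real.exp_nat_mul, mul_one]
  have h3 : ((n : ℝ) + 2) ^ 2 ≤ Real.exp (2 * (n + 2)) := by
    calc ((n : ℝ) + 2) ^ 2 ≤ Real.exp (n + 2) ^ 2 := by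
          gcongr; linarith [Real.add_one_le_exp ((n : ℝ) + 2)]
      _ = _ := by rw [← Real.exp_nat_mul]; norm_num
  have h4 : Real.log D ≤ Real.exp D := by
    have := Real.log_le_sub_one_of_pos hD0
    linarith [Real.add_one_le_exp D]
  have h5 : 0 ≤ Real.log D := Real.log_nonneg hD1
  calc _ ≤ (2 * ((n + 2) ^ 2 * 2 ^ k)) * Real.log D := by gcongr
    _ ≤ (Real.exp 1 * (Real.exp (2 * (n + 2)) * Real.exp k)) * Real.exp D := by gcongr
    _ = Real.exp (1 + (2 * (n + 2) + k) + D) := by simp only [Real.exp_add]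
    _ ≤ _ := by
      apply Real.exp_le_exp.2
      have h6 : ((2 * n + 39) * (1 + X)) * D ≤ D ^ 2 := by rw [sq]; gcongr
      have h7 : (2 * n + 39) * 1 ≤ (2 * n + 39) * D := by gcongr
      nlinarith [mul_nonneg (mul_nonneg hn (by linarith : 0 ≤ X)) hD0.le,
        mul_nonneg (by linarith : 0 ≤ X) hD0.le]

lemma uc_num2 {n : ℕ} {C X q : ℝ} (hX : 1 ≤ X) (hq : 0 ≤ q) (hC : q + n + 39 ≤ C) :
    12 * X ^ 2 + q * X ^ n ≤ Real.exp (C ^ (1 + X)) ∧ C * (1 + X) ≤ Real.exp (C ^ (1 + X)) := by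
  have hn : (0 : ℝ) ≤ n := Nat.cast_nonneg n
  have hC0 : 0 < C := by linarith
  have h1 : C * (1 + X) ≤ C ^ (1 + X) := by
    rw [Real.rpow_add hC0, Real.rpow_one]
    apply mul_le_mul_of_nonneg_left _ hC0.le
    calc 1 + X ≤ Real.exp X := by linarith [Real.add_one_le_exp X]
      _ = Real.exp 1 ^ X := by rw [← Real.exp_mul, one_mul]
      _ ≤ C ^ X := by
        apply Real.rpow_le_rpow (by positivity) _ (by linarith)
        linarith [Real.exp_one_lt_d9]
  refine ⟨?_, ?_⟩
  · refine le_trans ?_ (Real.exp_le_exp.2 h1)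
    have hp : ∀ m : ℕ, X ^ m ≤ Real.exp (m * X) := by
      intro m
      rw [Real.exp_nat_mul]
      gcongr
      linarith [Real.add_one_le_exp X]
    have a1 : X ^ 2 ≤ X ^ (n + 2) := pow_le_pow_right₀ hX (by omega)
    have a2 : X ^ n ≤ X ^ (n + 2) := pow_le_pow_right₀ hX (by omega)
    calc 12 * X ^ 2 + q * X ^ n ≤ 12 * X ^ (n + 2) + q * X ^ (n + 2) := by gcongr
      _ = (12 + q) * X ^ (n + 2) := by ring
      _ ≤ Real.exp (12 + q) * Real.exp ((n + 2 : ℕ) * X) := by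
        gcongr
        · linarith [Real.add_one_le_exp (12 + q)]
        · exact hp _
      _ = Real.exp (12 + q + (n + 2 : ℕ) * X) := by simp only [Real.exp_add]
      _ ≤ _ := by
        apply Real.exp_le_exp.2
        push_cast
        nlinarith
  · linarith [Real.add_one_le_exp (C ^ (1 + X))]

end UCNumerics

set_option maxHeartbeats 2000000 in
lemma uc_main (n : ℕ) (hn : 1 ≤ n) :
    ∃ C > (0 : ℝ),
      ∀ (x₀ : EuclideanSpace ℝ (Fin n)) (r a T : ℝ), 0 < r → 0 < a → 0 < T →
        ∀ u₀ : EuclideanSpace ℝ (Fin n) → ℂ, IsTestFun n u₀ →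
          ∀ ε : ℝ, ε ∈ Set.Ioo (0 : ℝ) 1 →
            (∫ x, ‖u₀ x‖ ^ 2) ≤
              (1 + T) ^ (2 * n + 6) *
                Real.exp (C ^ (1 + (‖x₀‖ + r + 1) / min (a * T) r)) *
                (ε * ((∫ x, Real.exp (a * ‖x‖) * ‖u₀ x‖ ^ 2) +
                      ∫ ξ, (1 + ‖ξ‖ ^ 2) ^ (n + 3) * ‖fourierTransformPaper n u₀ ξ‖ ^ 2) +
                  ε * Real.exp (Real.exp (ε ^ (-2 : ℝ))) *
                    ∫ x in closedBall x₀ r, ‖schrodingerSol n u₀ T x‖ ^ 2) := by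
  have hA := ucA_pos n
  have hW := ucW_pos n
  set Q : ℝ := ucW n * ucA n with hQ
  have hQ0 : 0 < Q := by positivity
  set C' : ℝ := 4 ^ (n + 1) / Q with hC'
  have hC'0 : 0 < C' := by positivity
  have hn0 : (0 : ℝ) ≤ n := Nat.cast_nonneg n
  set C : ℝ := Q * (1 + C') + 2 * n + 39 with hC
  have hC0 : 0 < C := by positivity
  refine ⟨C, hC0, ?_⟩
  intro x₀ r a T hr ha hT u₀ hu ε hε
  obtain ⟨hε0, hε1⟩ := hε
  set ρ := min (a * T) r with hρdef
  have hρ : 0 < ρ := lt_min (by positivity) hr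
  have hρa : ρ ≤ a * T := min_le_left _ _
  have hρr : ρ ≤ r := min_le_right _ _
  set X := (‖x₀‖ + r + 1) / ρ with hXdef
  have hxn := norm_nonneg x₀
  have hX : 1 ≤ X := by rw [hXdef, one_le_div hρ]; linarith
  have hX1 : ρ⁻¹ ≤ X := by
    rw [hXdef, inv_eq_one_div]; gcongr; linarith
  have hX2 : ‖x₀‖ / ρ ≤ X := by rw [hXdef]; gcongr; linarith
  set K := Real.exp (C ^ (1 + X)) with hK
  have hK0 : 0 < K := Real.exp_pos _
  obtain ⟨hK1, hK2⟩ := uc_num2 (n := n) (C := C) (X := X) (q := Q * (1 + C')) hX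
    (by positivity) (by linarith)
  rw [← hK] at hK1 hK2
  set M := ∫ x, Real.exp (a * ‖x‖) * ‖u₀ x‖ ^ 2 with hM
  set H := ∫ ξ, (1 + ‖ξ‖ ^ 2) ^ (n + 3) * ‖fourierTransformPaper n u₀ ξ‖ ^ 2 with hH
  set S := ∫ x in closedBall x₀ r, ‖schrodingerSol n u₀ T x‖ ^ 2 with hS
  have hM0 : 0 ≤ M := integral_nonneg fun y => by positivity
  have hH0 : 0 ≤ H := integral_nonneg fun y => by positivity
  have hS0 : 0 ≤ S := integral_nonneg fun y => by positivity
  have hLM : ∫ x, ‖u₀ x‖ ^ 2 ≤ M := by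
    apply integral_mono_of_nonneg (Eventually.of_forall fun y => by positivity)
      (uc_weight_int hu a)
    filter_upwards with y
    have : 1 ≤ Real.exp (a * ‖y‖) := Real.one_le_exp (by positivity)
    have h2 : 0 ≤ ‖u₀ y‖ ^ 2 := by positivity
    exact le_mul_of_one_le_left h2 this
  set P := (1 + T) ^ (2 * n + 6) with hP
  have hP1 : 1 ≤ P := one_le_pow₀ (by linarith)
  have hPT : T ^ 2 ≤ P := by
    calc T ^ 2 ≤ (1 + T) ^ 2 := by gcongr; linarith
      _ ≤ _ := pow_le_pow_right₀ (by linarith) (by omega)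
  clear_value P K M H S C' Q ρ X
  rcases le_or_gt 1 (K * ε) with hc | hc
  · have h1 : 1 ≤ P * (K * ε) := one_le_mul_of_one_le_of_one_le hP1 hc
    have h2 : 0 ≤ P * K * (ε * H + ε * Real.exp (Real.exp (ε ^ (-2 : ℝ))) * S) := by positivity
    calc _ ≤ 1 * M := by rw [one_mul]; exact hLM
      _ ≤ P * (K * ε) * M := by gcongr
      _ ≤ P * (K * ε) * M + P * K * (ε * H + ε * Real.exp (Real.exp (ε ^ (-2 : ℝ))) * S) := by
        linarith
      _ = _ := by ring
  rcases hM0.eq_or_lt with hMz | hMpos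
  · rw [← hMz] at hLM ⊢
    refine hLM.trans ?_
    positivity
  set D := ε⁻¹ with hD
  have hD0 : 0 < D := by positivity
  have hDε : D * ε = 1 := inv_mul_cancel₀ hε0.ne'
  have hDK : K ≤ D := by
    rw [hD, ← one_div, le_div_iff₀ hε0]; exact hc.le
  have hDC : (2 * n + 39) * (1 + X) ≤ D := by
    refine le_trans ?_ (hK2.trans hDK)
    have : 0 ≤ Q * (1 + C') := by positivity
    gcongr
    linarith
  have hD1 : 1 ≤ D := (one_le_inv₀ hε0).2 hε1.le
  set k := ⌈16 * (D + ‖x₀‖) / ρ⌉₊ with hk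
  have hk1 : 16 * (D + ‖x₀‖) / ρ ≤ k := Nat.le_ceil _
  have hk2 : (k : ℝ) ≤ 32 * X * D + 1 := by
    have h1 : (k : ℝ) < 16 * (D + ‖x₀‖) / ρ + 1 := Nat.ceil_lt_add_one (by positivity)
    have h2 : 16 * (D + ‖x₀‖) / ρ = 16 * (D * ρ⁻¹ + ‖x₀‖ / ρ) := by
      rw [div_eq_mul_inv, div_eq_mul_inv]; ring
    have h3 : D * ρ⁻¹ ≤ D * X := by gcongr
    have h4 : X ≤ D * X := le_mul_of_one_le_left (by linarith) hD1
    rw [h2] at h1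
    linarith
  have hk3 : D + ‖x₀‖ ≤ (k / 2 + 2) * (ρ / 8) := by
    rw [div_le_iff₀ hρ] at hk1
    linarith
  have hE := uc_num1 hX hDC hk2
  have key := uc_combine hu ha hT hρ hρa hρr (hM ▸ hMpos) x₀ k hD0 hk3 (τ := ε ^ (n + 2)) (by positivity)
  rw [← hM, ← hH, ← hS, ← hQ, ← hC'] at key
  have hrp : ε ^ (-2 : ℝ) = D ^ 2 := by
    rw [Real.rpow_neg hε0.le, Real.rpow_two, hD, inv_pow]
  rw [hrp]
  set N := 2 ^ k * (n + 2) with hN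
  have hDinv : D⁻¹ = ε := by rw [hD, inv_inv]
  have hρn : ρ⁻¹ ^ n ≤ X ^ n := by gcongr
  have e1 : D ^ n * ε ^ (n + 2) = ε ^ 2 := by
    rw [pow_add, ← mul_assoc, ← mul_pow, hDε, one_pow, one_mul]
  have e2 : D ^ n * ((ε ^ (n + 2)) ^ N)⁻¹ = ε * D ^ (n + 1 + (n + 2) * N) := by
    rw [← pow_mul, ← inv_pow, ← hD, pow_add, pow_succ D n]
    linear_combination (-(D ^ n * D ^ ((n + 2) * N))) * hDε
  have hεε : ε ^ 2 ≤ ε := pow_le_of_le_one hε0.le hε1.le (by norm_num)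
  have hMH : 0 ≤ M + H := by positivity
  have b1 : D⁻¹ ^ 2 * (T ^ 2 * (8 + 4 / ρ ^ 2)) * (M + H) ≤ ε * (P * (12 * X ^ 2)) * (M + H) := by
    rw [hDinv]
    have h1 : 8 + 4 / ρ ^ 2 ≤ 12 * X ^ 2 := by
      have : 4 / ρ ^ 2 = 4 * ρ⁻¹ ^ 2 := by rw [inv_pow]; ring
      rw [this]
      have h2 : ρ⁻¹ ^ 2 ≤ X ^ 2 := by gcongr
      have h3 : 1 ≤ X ^ 2 := one_le_pow₀ hX
      linarith
    gcongr
  have b2 : Q * ρ⁻¹ ^ n * (D ^ n * ε ^ (n + 2)) * M ≤ ε * (P * (Q * X ^ n)) * (M + H) := by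
    rw [e1]
    calc Q * ρ⁻¹ ^ n * ε ^ 2 * M ≤ Q * X ^ n * ε * (M + H) := by
          gcongr; linarith
      _ = ε * (1 * (Q * X ^ n)) * (M + H) := by ring
      _ ≤ _ := by gcongr
  have b3 : Q * ρ⁻¹ ^ n * C' * (D ^ n * ((ε ^ (n + 2)) ^ N)⁻¹) * S ≤
      P * K * (ε * Real.exp (Real.exp (D ^ 2)) * S) := by
    rw [e2]
    have h1 : Q * ρ⁻¹ ^ n * C' ≤ P * K := by
      calc Q * ρ⁻¹ ^ n * C' ≤ Q * X ^ n * C' := by gcongr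
        _ ≤ 12 * X ^ 2 + Q * (1 + C') * X ^ n := by
          have h2 : 0 ≤ Q * X ^ n := by positivity
          linarith [sq_nonneg X]
        _ ≤ 1 * K := by rw [one_mul]; exact hK1
        _ ≤ P * K := by gcongr
    calc _ ≤ P * K * (ε * Real.exp (Real.exp (D ^ 2))) * S := by gcongr
      _ = _ := by ring
  have b4 : ε * (P * (12 * X ^ 2)) * (M + H) + ε * (P * (Q * X ^ n)) * (M + H) ≤
      P * K * (ε * (M + H)) := by
    have h1 : 12 * X ^ 2 + Q * X ^ n ≤ K := by
      have : 0 ≤ Q * C' * X ^ n := by positivity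
      linarith
    calc _ = P * (12 * X ^ 2 + Q * X ^ n) * (ε * (M + H)) := by ring
      _ ≤ _ := by gcongr
  calc _ ≤ _ := key
    _ = D⁻¹ ^ 2 * (T ^ 2 * (8 + 4 / ρ ^ 2)) * (M + H) +
        Q * ρ⁻¹ ^ n * (D ^ n * ε ^ (n + 2)) * M +
        Q * ρ⁻¹ ^ n * C' * (D ^ n * ((ε ^ (n + 2)) ^ N)⁻¹) * S := by
        rw [hQ]; ring
    _ ≤ _ := by
        rw [mul_add (P * K)]
        linarith

/-- Theorem 1.6: there is `C = C(n) > 0` such that for all `x₀ ∈ ℝⁿ`, `r, a, T > 0`,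
every `u₀ ∈ C₀^∞(ℝⁿ;ℂ)` and every `ε ∈ (0,1)`,
`∫|u₀|² ≤ (1+T)^{2n+6} e^{C^{1+(|x₀|+r+1)/((aT)∧r)}}
  (ε (∫ e^{a|x|}|u₀|² + ‖u₀‖²_{H^{n+3}}) + ε e^{e^{ε^{-2}}} ∫_{B_r(x₀)}|u(·,T;u₀)|²)`,
where `‖f‖²_{H^k} = ∫ (1+|ξ|²)^k |f̂(ξ)|² dξ`. -/
theorem unique_continuation_sobolev (n : ℕ) (hn : 1 ≤ n) :
    ∃ C > (0 : ℝ),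
      ∀ (x₀ : EuclideanSpace ℝ (Fin n)) (r a T : ℝ), 0 < r → 0 < a → 0 < T →
        ∀ u₀ : EuclideanSpace ℝ (Fin n) → ℂ, IsTestFun n u₀ →
          ∀ ε : ℝ, ε ∈ Set.Ioo (0 : ℝ) 1 →
            (∫ x, ‖u₀ x‖ ^ 2) ≤
              (1 + T) ^ (2 * n + 6) *
                Real.exp (C ^ (1 + (‖x₀‖ + r + 1) / min (a * T) r)) *
                (ε * ((∫ x, Real.exp (a * ‖x‖) * ‖u₀ x‖ ^ 2) +
                      ∫ ξ, (1 + ‖ξ‖ ^ 2) ^ (n + 3) * ‖fourierTransformPaper n u₀ ξ‖ ^ 2) +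
                  ε * Real.exp (Real.exp (ε ^ (-2 : ℝ))) *
                    ∫ x in closedBall x₀ r, ‖schrodingerSol n u₀ T x‖ ^ 2) := by
  exact uc_main n hn
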